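/- arXiv:1511.09340 — 3 statements merged into one kernel-verified Lean document; each statement's English description precedes it below -/
import Mathlib

section
/- Let p be a prime with p ≡ 1 (mod 4). Then the set of quadruples (x₀, x₁, x₂, x₃) of integers satisfying x₀² + x₁² + x₂² + x₃² = p, with x₀ > 0 and x₀ odd, and x₁, x₂, x₃ all even, has exactly p + 1 elements. -/
/-- The sum of the squares of the entries of an integer quadruple, i.e. its quaternion norm. -/
def quadNorm (x : ℤ × ℤ × ℤ × ℤ) : ℤ :=
  x.1 ^ 2 + x.2.1 ^ 2 + x.2.2.1 ^ 2 + x.2.2.2 ^ 2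

/-- Hamilton's product of integer quadruples. -/
def quadMul (u x : ℤ × ℤ × ℤ × ℤ) : ℤ × ℤ × ℤ × ℤ :=
  (u.1 * x.1 - u.2.1 * x.2.1 - u.2.2.1 * x.2.2.1 - u.2.2.2 * x.2.2.2,
   u.1 * x.2.1 + u.2.1 * x.1 + u.2.2.1 * x.2.2.2 - u.2.2.2 * x.2.2.1,
   u.1 * x.2.2.1 - u.2.1 * x.2.2.2 + u.2.2.1 * x.1 + u.2.2.2 * x.2.1,
   u.1 * x.2.2.2 + u.2.1 * x.2.2.1 - u.2.2.1 * x.2.1 + u.2.2.2 * x.1)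

/-- For `ι ^ 2 = -1`, the quaternion `x` acts on `F × F` by a `2 × 2` matrix;
`AnnihilatesVec ι v x` says that this matrix kills `v`. -/
def AnnihilatesVec {F : Type*} [Field F] (ι : F) (v : F × F) (x : ℤ × ℤ × ℤ × ℤ) : Prop :=
  ((x.1 : F) + x.2.1 * ι) * v.1 + ((x.2.2.1 : F) + x.2.2.2 * ι) * v.2 = 0 ∧
    ((x.1 : F) - x.2.1 * ι) * v.2 - ((x.2.2.1 : F) - x.2.2.2 * ι) * v.1 = 0

/-- Representatives of the points of the projective line over `F`. -/
def projRep {F : Type*} [Field F] : Option F → F × F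
  | none => (1, 0)
  | some s => (s, 1)

theorem quadNorm_quadMul (u x : ℤ × ℤ × ℤ × ℤ) :
    quadNorm (quadMul u x) = quadNorm u * quadNorm x := by
  simp only [quadNorm, quadMul]
  ring

theorem quadNorm_smul (m : ℤ) (x : ℤ × ℤ × ℤ × ℤ) : quadNorm (m • x) = m ^ 2 * quadNorm x := by
  simp only [quadNorm, Prod.smul_fst, Prod.smul_snd, smul_eq_mul]
  ring

theorem projRep_ne_zero {F : Type*} [Field F] (t : Option F) : projRep t ≠ 0 := by
  cases t <;> simp [projRep]

section Field

variable {F : Type*} [Field F] {ι : F}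

theorem AnnihilatesVec.quadMul (hι : ι ^ 2 = -1) {v : F × F} {x : ℤ × ℤ × ℤ × ℤ}
    (hx : AnnihilatesVec ι v x) (u : ℤ × ℤ × ℤ × ℤ) : AnnihilatesVec ι v (quadMul u x) := by
  obtain ⟨α, β, γ, δ⟩ := u
  obtain ⟨a, b, c, d⟩ := x
  obtain ⟨h₁, h₂⟩ := hx
  simp only [AnnihilatesVec, _root_.quadMul] at *
  push_cast
  constructor
  · linear_combination (α + β * ι) * h₁ + (γ + δ * ι) * h₂
      - ((β * b + δ * d) * v.1 + (β * d - δ * b) * v.2) * hι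
  · linear_combination (α - β * ι) * h₂ - (γ - δ * ι) * h₁
      - ((β * b + δ * d) * v.2 - (β * d - δ * b) * v.1) * hι

theorem AnnihilatesVec.of_smul {v : F × F} {x : ℤ × ℤ × ℤ × ℤ} {m : ℤ} (hm : (m : F) ≠ 0)
    (hx : AnnihilatesVec ι v (m • x)) : AnnihilatesVec ι v x := by
  obtain ⟨h₁, h₂⟩ := hx
  simp only [AnnihilatesVec, Prod.smul_fst, Prod.smul_snd, smul_eq_mul, Int.cast_mul] at *
  constructor <;> apply mul_left_cancel₀ hm
  · linear_combination h₁
  · linear_combination h₂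

/-- The quadruples killing a nonzero vector form a totally isotropic lattice. -/
theorem AnnihilatesVec.inner_eq_zero (hι : ι ^ 2 = -1) (h2 : (2 : F) ≠ 0) {v : F × F} (hv : v ≠ 0)
    {x y : ℤ × ℤ × ℤ × ℤ} (hx : AnnihilatesVec ι v x) (hy : AnnihilatesVec ι v y) :
    ((x.1 * y.1 + x.2.1 * y.2.1 + x.2.2.1 * y.2.2.1 + x.2.2.2 * y.2.2.2 : ℤ) : F) = 0 := by
  obtain ⟨a, b, c, d⟩ := x
  obtain ⟨a', b', c', d'⟩ := y
  obtain ⟨h₁, h₂⟩ := hx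
  obtain ⟨h₃, h₄⟩ := hy
  simp only at *
  push_cast
  apply mul_left_cancel₀ h2
  by_cases hv1 : v.1 = 0
  · have hv2 : v.2 ≠ 0 := fun h ↦ hv (Prod.ext hv1 h)
    apply mul_left_cancel₀ hv2
    linear_combination (a + b * ι) * h₄ + (a' + b' * ι) * h₂ + (c - d * ι) * h₃
      + (c' - d' * ι) * h₁ + 2 * v.2 * (b * b' + d * d') * hι
  · apply mul_left_cancel₀ hv1
    linear_combination (a - b * ι) * h₃ + (a' - b' * ι) * h₁ - (c + d * ι) * h₄
      - (c' + d' * ι) * h₂ + 2 * v.1 * (b * b' + d * d') * hι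

theorem eq_zero_of_add_mul_sub_mul (hι : ι ^ 2 = -1) (h2 : (2 : F) ≠ 0) {a b : F}
    (h₁ : a + b * ι = 0) (h₂ : a - b * ι = 0) : a = 0 ∧ b = 0 := by
  constructor <;> apply mul_left_cancel₀ h2
  · linear_combination h₁ + h₂
  · linear_combination -ι * h₁ + ι * h₂ + 2 * b * hι

theorem existsUnique_annihilatesVec_projRep (hι : ι ^ 2 = -1) (h2 : (2 : F) ≠ 0)
    {x : ℤ × ℤ × ℤ × ℤ} (hN : (quadNorm x : F) = 0)
    (hx : ¬((x.1 : F) = 0 ∧ (x.2.1 : F) = 0 ∧ (x.2.2.1 : F) = 0 ∧ (x.2.2.2 : F) = 0)) :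
    ∃! t : Option F, AnnihilatesVec ι (projRep t) x := by
  obtain ⟨a, b, c, d⟩ := x
  simp only [quadNorm, AnnihilatesVec] at *
  push_cast at hN
  have hprod : ((a : F) + b * ι) * (a - b * ι) + (c + d * ι) * (c - d * ι) = 0 := by
    linear_combination hN - (b ^ 2 + d ^ 2 : F) * hι
  have hne : ¬((a : F) + b * ι = 0 ∧ (a : F) - b * ι = 0 ∧
      (c : F) + d * ι = 0 ∧ (c : F) - d * ι = 0) := by
    rintro ⟨h₁, h₂, h₃, h₄⟩
    obtain ⟨ha, hb⟩ := eq_zero_of_add_mul_sub_mul hι h2 h₁ h₂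
    obtain ⟨hc, hd⟩ := eq_zero_of_add_mul_sub_mul hι h2 h₃ h₄
    exact hx ⟨ha, hb, hc, hd⟩
  generalize (a : F) + b * ι = z at *
  generalize (a : F) - b * ι = z' at *
  generalize (c : F) + d * ι = w at *
  generalize (c : F) - d * ι = w' at *
  apply existsUnique_of_exists_of_unique
  · by_cases hz : z = 0
    · by_cases hw : w' = 0
      · exact ⟨none, by simp [projRep, hz, hw]⟩
      · refine ⟨some (z' / w'), ?_⟩
        have : w = 0 := by simpa [hz, hw] using hprod
        simp only [projRep, hz, this]
        constructor
        · ring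
        · field_simp
          ring
    · refine ⟨some (-w / z), ?_⟩
      simp only [projRep]
      constructor
      · field_simp
        ring
      · field_simp
        linear_combination hprod
  · rintro (_ | s) (_ | t) hs ht <;> simp only [projRep] at hs ht
    · rfl
    · grind
    · grind
    · congr 1
      by_contra hst
      have hst' : s - t ≠ 0 := sub_ne_zero.2 hst
      have hz : z = 0 := mul_left_cancel₀ hst' (by linear_combination hs.1 - ht.1)
      have hw : w' = 0 := mul_left_cancel₀ hst' (by linear_combination ht.2 - hs.2)
      grind

end Field

/-- A pigeonhole argument: some short nonzero quadruple kills a given vector. -/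
theorem exists_annihilatesVec_quadNorm_lt {p : ℕ} [Fact p.Prime] (ι : ZMod p)
    (v : ZMod p × ZMod p) :
    ∃ x, AnnihilatesVec ι v x ∧ 0 < quadNorm x ∧ quadNorm x < 4 * p := by
  have hp : p.Prime := Fact.out
  let r := p.sqrt
  have hr : r * r < p := lt_of_le_of_ne (Nat.sqrt_le p) fun h ↦
    hp.prime.not_isSquare ⟨r, h.symm⟩
  have hr' : p < (r + 1) * (r + 1) := Nat.lt_succ_sqrt p
  let I := Fin (r + 1)
  let f : I × I × I × I → ZMod p × ZMod p := fun x ↦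
    (((x.1 : ℕ) + (x.2.1 : ℕ) * ι) * v.1 + ((x.2.2.1 : ℕ) + (x.2.2.2 : ℕ) * ι) * v.2,
      ((x.1 : ℕ) - (x.2.1 : ℕ) * ι) * v.2 - ((x.2.2.1 : ℕ) - (x.2.2.2 : ℕ) * ι) * v.1)
  have hcard : Fintype.card (ZMod p × ZMod p) < Fintype.card (I × I × I × I) := by
    simp only [Fintype.card_prod, ZMod.card, I, Fintype.card_fin]
    nlinarith
  obtain ⟨⟨a, b, c, d⟩, ⟨a', b', c', d'⟩, hne, hf⟩ := Fintype.exists_ne_map_eq_of_card_lt f hcard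
  simp only [f, Prod.mk.injEq] at hf
  have hsq : ∀ i j : I, ((i : ℤ) - j) ^ 2 < p := fun i j ↦ by
    have hi := i.2
    have hj := j.2
    have : |(i : ℤ) - j| ≤ |(r : ℤ)| := by
      rw [Nat.abs_cast, abs_le]
      omega
    have := sq_le_sq.2 this
    zify at hr
    nlinarith
  have hpos : ∀ i j : I, i ≠ j → 0 < ((i : ℤ) - j) ^ 2 := fun i j h ↦ by
    have : (i : ℤ) - j ≠ 0 := fun h' ↦ h (Fin.ext (by omega))
    positivity
  refine ⟨((a : ℤ) - a', (b : ℤ) - b', (c : ℤ) - c', (d : ℤ) - d'), ⟨?_, ?_⟩, ?_, ?_⟩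
  · push_cast
    linear_combination hf.1
  · push_cast
    linear_combination hf.2
  · simp only [quadNorm]
    have := sq_nonneg ((a : ℤ) - a')
    have := sq_nonneg ((b : ℤ) - b')
    have := sq_nonneg ((c : ℤ) - c')
    have := sq_nonneg ((d : ℤ) - d')
    by_contra! h
    refine hne ?_
    simp only [Prod.mk.injEq]
    refine ⟨?_, ?_, ?_, ?_⟩ <;> by_contra h' <;> have := hpos _ _ h' <;> omega
  · simp only [quadNorm]
    linarith [hsq a a', hsq b b', hsq c c', hsq d d']

theorem exists_quadMul_eq_two_smul {x : ℤ × ℤ × ℤ × ℤ} (hx : 2 ∣ quadNorm x) :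
    ∃ u y, quadNorm u = 2 ∧ quadMul u x = (2 : ℤ) • y := by
  obtain ⟨a, b, c, d⟩ := x
  have key : ∀ a b c d : ZMod 2, a ^ 2 + b ^ 2 + c ^ 2 + d ^ 2 = 0 →
      (a = b ∧ c = d) ∨ (a = c ∧ b = d) ∨ (a = d ∧ b = c) := by decide
  have hx' : ((quadNorm (a, b, c, d) : ℤ) : ZMod 2) = 0 :=
    (ZMod.intCast_zmod_eq_zero_iff_dvd _ 2).2 hx
  simp only [quadNorm] at hx'
  push_cast at hx'
  have hdvd : ∀ m n : ℤ, (m : ZMod 2) = n → (2 : ℤ) ∣ n - m := fun m n h ↦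
    (ZMod.intCast_eq_intCast_iff_dvd_sub m n 2).1 h
  rcases key _ _ _ _ hx' with ⟨h, h'⟩ | ⟨h, h'⟩ | ⟨h, h'⟩ <;>
    obtain ⟨m, hm⟩ := hdvd _ _ h <;> obtain ⟨n, hn⟩ := hdvd _ _ h'
  · refine ⟨(1, 1, 0, 0), (-m, a + m, -n, c + n), by norm_num [quadNorm], ?_⟩
    simp only [quadMul, Prod.smul_mk, smul_eq_mul, Prod.mk.injEq]
    omega
  · refine ⟨(1, 0, 1, 0), (-m, b + n, a + m, n), by norm_num [quadNorm], ?_⟩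
    simp only [quadMul, Prod.smul_mk, smul_eq_mul, Prod.mk.injEq]
    omega
  · refine ⟨(1, 0, 0, 1), (-m, -n, b + n, a + m), by norm_num [quadNorm], ?_⟩
    simp only [quadMul, Prod.smul_mk, smul_eq_mul, Prod.mk.injEq]
    omega

theorem exists_quadMul_eq_three_smul {x : ℤ × ℤ × ℤ × ℤ} (hx : 3 ∣ quadNorm x) :
    ∃ u y, quadNorm u = 3 ∧ quadMul u x = (3 : ℤ) • y := by
  obtain ⟨a, b, c, d⟩ := x
  have key : ∀ a b c d : ZMod 3, a ^ 2 + b ^ 2 + c ^ 2 + d ^ 2 = 0 →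
      ∃ ε δ : ZMod 3, (ε = 1 ∨ ε = -1) ∧ (δ = 1 ∨ δ = -1) ∧
        a - ε * b - δ * c = 0 ∧ b + ε * a + δ * d = 0 ∧
        c - ε * d + δ * a = 0 ∧ d + ε * c - δ * b = 0 := by decide
  have hx' : ((quadNorm (a, b, c, d) : ℤ) : ZMod 3) = 0 :=
    (ZMod.intCast_zmod_eq_zero_iff_dvd _ 3).2 hx
  simp only [quadNorm] at hx'
  push_cast at hx'
  have lift : ∀ e : ZMod 3, e = 1 ∨ e = -1 → ∃ n : ℤ, n ^ 2 = 1 ∧ (n : ZMod 3) = e := by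
    rintro e (rfl | rfl)
    · exact ⟨1, by norm_num, by norm_num⟩
    · exact ⟨-1, by norm_num, by norm_num⟩
  obtain ⟨ε, δ, hε, hδ, h₁, h₂, h₃, h₄⟩ := key _ _ _ _ hx'
  obtain ⟨ε, hε2, rfl⟩ := lift ε hε
  obtain ⟨δ, hδ2, rfl⟩ := lift δ hδ
  norm_cast at h₁ h₂ h₃ h₄
  obtain ⟨k₁, h₁⟩ := (ZMod.intCast_zmod_eq_zero_iff_dvd _ 3).1 h₁
  obtain ⟨k₂, h₂⟩ := (ZMod.intCast_zmod_eq_zero_iff_dvd _ 3).1 h₂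
  obtain ⟨k₃, h₃⟩ := (ZMod.intCast_zmod_eq_zero_iff_dvd _ 3).1 h₃
  obtain ⟨k₄, h₄⟩ := (ZMod.intCast_zmod_eq_zero_iff_dvd _ 3).1 h₄
  refine ⟨(1, ε, δ, 0), (k₁, k₂, k₃, k₄), ?_, ?_⟩
  · simp only [quadNorm]
    linear_combination hε2 + hδ2
  · simp only [quadMul, Prod.smul_mk, smul_eq_mul, Prod.mk.injEq]
    push_cast at *
    refine ⟨?_, ?_, ?_, ?_⟩ <;> linarith

/-- Up to a unit, a quadruple of norm `1` modulo `4` has a positive odd entry followed by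
even entries. -/
theorem exists_quadMul_odd_even {x : ℤ × ℤ × ℤ × ℤ} (hx : quadNorm x % 4 = 1) :
    ∃ u, quadNorm u = 1 ∧ 0 < (quadMul u x).1 ∧ Odd (quadMul u x).1 ∧
      Even (quadMul u x).2.1 ∧ Even (quadMul u x).2.2.1 ∧ Even (quadMul u x).2.2.2 := by
  obtain ⟨a, b, c, d⟩ := x
  have hsq : ∀ n : ℤ, n % 2 = 0 ∧ n ^ 2 % 4 = 0 ∨ n % 2 = 1 ∧ n ^ 2 % 4 = 1 := fun n ↦ by
    rcases Int.even_or_odd n with h | h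
    · exact .inl ⟨Int.even_iff.1 h, by obtain ⟨k, rfl⟩ := h; ring_nf; omega⟩
    · exact .inr ⟨Int.odd_iff.1 h, by obtain ⟨k, rfl⟩ := h; ring_nf; omega⟩
  have key : ∃ u : ℤ × ℤ × ℤ × ℤ, quadNorm u = 1 ∧ Odd (quadMul u (a, b, c, d)).1 ∧
      Even (quadMul u (a, b, c, d)).2.1 ∧ Even (quadMul u (a, b, c, d)).2.2.1 ∧
      Even (quadMul u (a, b, c, d)).2.2.2 := by
    simp only [quadNorm] at hx
    rcases hsq a with ha | ha
    · rcases hsq b with hb | hb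
      · rcases hsq c with hc | hc
        · refine ⟨(0, 0, 0, 1), ?_⟩
          simp only [quadNorm, quadMul, Int.odd_iff, Int.even_iff]
          have := hsq d
          omega
        · refine ⟨(0, 0, 1, 0), ?_⟩
          simp only [quadNorm, quadMul, Int.odd_iff, Int.even_iff]
          have := hsq d
          omega
      · refine ⟨(0, 1, 0, 0), ?_⟩
        simp only [quadNorm, quadMul, Int.odd_iff, Int.even_iff]
        have := hsq c
        have := hsq d
        omega
    · refine ⟨(1, 0, 0, 0), ?_⟩
      simp only [quadNorm, quadMul, Int.odd_iff, Int.even_iff]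
      have := hsq b
      have := hsq c
      have := hsq d
      omega
  obtain ⟨u, hu, h₀, h₁, h₂, h₃⟩ := key
  rcases lt_or_ge 0 (quadMul u (a, b, c, d)).1 with hpos | hneg
  · exact ⟨u, hu, hpos, h₀, h₁, h₂, h₃⟩
  · have hmul : quadMul (-u) (a, b, c, d) = -quadMul u (a, b, c, d) := by
      simp only [quadMul, Prod.fst_neg, Prod.snd_neg, Prod.neg_mk, Prod.mk.injEq]
      refine ⟨?_, ?_, ?_, ?_⟩ <;> ring
    refine ⟨-u, by simpa [quadNorm] using hu, ?_⟩
    rw [hmul]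
    simp only [Prod.fst_neg, Prod.snd_neg, even_neg, odd_neg]
    refine ⟨?_, h₀, h₁, h₂, h₃⟩
    have := Int.odd_iff.1 h₀
    omega

theorem exists_annihilatesVec_quadNorm_eq {p : ℕ} [Fact p.Prime] (hp4 : p % 4 = 1) {ι : ZMod p}
    (hι : ι ^ 2 = -1) {v : ZMod p × ZMod p} (hv : v ≠ 0) :
    ∃ x, AnnihilatesVec ι v x ∧ quadNorm x = p := by
  have hp : p.Prime := Fact.out
  have hsmall : ∀ m : ℕ, m.Prime → m ≠ p → ((m : ℤ) : ZMod p) ≠ 0 := fun m hm hne h ↦ by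
    rw [Int.cast_natCast, ZMod.natCast_eq_zero_iff] at h
    exact hne ((Nat.prime_dvd_prime_iff_eq hp hm).1 h).symm
  have h2 : ((2 : ℤ) : ZMod p) ≠ 0 := hsmall 2 Nat.prime_two (by omega)
  have h3 : ((3 : ℤ) : ZMod p) ≠ 0 := hsmall 3 Nat.prime_three (by omega)
  obtain ⟨x, hx, hpos, hlt⟩ := exists_annihilatesVec_quadNorm_lt ι v
  have hdvd : (p : ℤ) ∣ quadNorm x := by
    rw [← ZMod.intCast_zmod_eq_zero_iff_dvd, ← hx.inner_eq_zero hι (by exact_mod_cast h2) hv hx]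
    simp only [quadNorm, sq]
  have descend : ∀ (m : ℤ), (m : ZMod p) ≠ 0 → quadNorm x = m * p →
      (∃ u y, quadNorm u = m ∧ quadMul u x = m • y) →
      ∃ x, AnnihilatesVec ι v x ∧ quadNorm x = p := by
    rintro m hm hN ⟨u, y, hu, hy⟩
    refine ⟨y, .of_smul hm (hy ▸ hx.quadMul hι u), ?_⟩
    have hm' : m ≠ 0 := by
      rintro rfl
      simp at hm
    have := quadNorm_quadMul u x
    rw [hy, quadNorm_smul, hu, hN] at this
    exact mul_left_cancel₀ (pow_ne_zero 2 hm') (by linear_combination this)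
  obtain ⟨m, hm⟩ := hdvd
  have hp0 : (0 : ℤ) < p := by exact_mod_cast hp.pos
  have hm0 : 0 < m := by nlinarith
  have hm4 : m < 4 := by nlinarith
  interval_cases m
  · exact ⟨x, hx, by rw [hm, mul_one]⟩
  · exact descend 2 h2 (by rw [hm, mul_comm])
      (exists_quadMul_eq_two_smul ⟨p, by rw [hm, mul_comm]⟩)
  · exact descend 3 h3 (by rw [hm, mul_comm])
      (exists_quadMul_eq_three_smul ⟨p, by rw [hm, mul_comm]⟩)

/-- Two vectors of the same length whose inner product is a nonzero multiple of the squared length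
are equal up to sign. -/
theorem eq_or_eq_neg_of_dvd_inner {n : ℤ} {x y : ℤ × ℤ × ℤ × ℤ} (hx : quadNorm x = n)
    (hy : quadNorm y = n)
    (hdvd : n ∣ x.1 * y.1 + x.2.1 * y.2.1 + x.2.2.1 * y.2.2.1 + x.2.2.2 * y.2.2.2)
    (hne : x.1 * y.1 + x.2.1 * y.2.1 + x.2.2.1 * y.2.2.1 + x.2.2.2 * y.2.2.2 ≠ 0) :
    x = y ∨ x = -y := by
  obtain ⟨a, b, c, d⟩ := x
  obtain ⟨a', b', c', d'⟩ := y
  obtain ⟨k, hk⟩ := hdvd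
  simp only [quadNorm] at *
  have hn : 0 < n := by
    have : 0 ≤ n := by rw [← hx]; positivity
    refine lt_of_le_of_ne this ?_
    rintro rfl
    simp [hk] at hne
  have hk0 : k ≠ 0 := by
    rintro rfl
    simp [hk] at hne
  have hle : k ≤ 1 := by
    nlinarith [sq_nonneg (a - a'), sq_nonneg (b - b'), sq_nonneg (c - c'), sq_nonneg (d - d')]
  have hge : -1 ≤ k := by
    nlinarith [sq_nonneg (a + a'), sq_nonneg (b + b'), sq_nonneg (c + c'), sq_nonneg (d + d')]
  have key : (a - k * a') ^ 2 + (b - k * b') ^ 2 + (c - k * c') ^ 2 + (d - k * d') ^ 2 = 0 := by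
    obtain rfl | rfl : k = 1 ∨ k = -1 := by omega
    · linear_combination hx + hy - 2 * hk
    · linear_combination hx + hy + 2 * hk
  have h₁ : a - k * a' = 0 := by
    nlinarith [sq_nonneg (b - k * b'), sq_nonneg (c - k * c'), sq_nonneg (d - k * d')]
  have h₂ : b - k * b' = 0 := by
    nlinarith [sq_nonneg (a - k * a'), sq_nonneg (c - k * c'), sq_nonneg (d - k * d')]
  have h₃ : c - k * c' = 0 := by
    nlinarith [sq_nonneg (a - k * a'), sq_nonneg (b - k * b'), sq_nonneg (d - k * d')]
  have h₄ : d - k * d' = 0 := by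
    nlinarith [sq_nonneg (a - k * a'), sq_nonneg (b - k * b'), sq_nonneg (c - k * c')]
  obtain rfl | rfl : k = 1 ∨ k = -1 := by omega
  · left
    simp only [Prod.mk.injEq]
    omega
  · right
    simp only [Prod.neg_mk, Prod.mk.injEq]
    omega

/-- Let `p` be a prime with `p ≡ 1 (mod 4)`. Then there are exactly
`p + 1` quadruples `(x₀, x₁, x₂, x₃)` of integers with
`x₀² + x₁² + x₂² + x₃² = p`, `x₀ > 0` odd, and `x₁, x₂, x₃` even. -/
theorem card_lps_generators (p : ℕ) (hp : p.Prime) (hp4 : p % 4 = 1) :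
    {x : ℤ × ℤ × ℤ × ℤ |
        x.1 ^ 2 + x.2.1 ^ 2 + x.2.2.1 ^ 2 + x.2.2.2 ^ 2 = (p : ℤ) ∧
        0 < x.1 ∧ Odd x.1 ∧ Even x.2.1 ∧ Even x.2.2.1 ∧ Even x.2.2.2}.ncard
      = p + 1 := by
  have : Fact p.Prime := ⟨hp⟩
  obtain ⟨ι, hι⟩ : ∃ ι : ZMod p, ι ^ 2 = -1 := by
    obtain ⟨ι, h⟩ := ZMod.exists_sq_eq_neg_one_iff.2 (show p % 4 ≠ 3 by omega)
    exact ⟨ι, by rw [h, sq]⟩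
  have h2 : (2 : ZMod p) ≠ 0 := by
    refine Ring.two_ne_zero ?_
    rw [ZMod.ringChar_zmod_n]
    omega
  set S := {x : ℤ × ℤ × ℤ × ℤ |
        x.1 ^ 2 + x.2.1 ^ 2 + x.2.2.1 ^ 2 + x.2.2.2 ^ 2 = (p : ℤ) ∧
        0 < x.1 ∧ Odd x.1 ∧ Even x.2.1 ∧ Even x.2.2.1 ∧ Even x.2.2.2}
  have hex : ∀ t : Option (ZMod p), ∃ x ∈ S, AnnihilatesVec ι (projRep t) x := fun t ↦ by
    obtain ⟨x, hx, hN⟩ := exists_annihilatesVec_quadNorm_eq hp4 hι (projRep_ne_zero t)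
    obtain ⟨u, hu, hux⟩ := exists_quadMul_odd_even (x := x) (by omega)
    refine ⟨quadMul u x, ⟨?_, hux⟩, hx.quadMul hι u⟩
    rw [← hN, ← one_mul (quadNorm x), ← hu, ← quadNorm_quadMul, quadNorm]
  have hunique : ∀ t : Option (ZMod p), ∀ x ∈ S, ∀ y ∈ S, AnnihilatesVec ι (projRep t) x →
      AnnihilatesVec ι (projRep t) y → x = y := by
    rintro t x ⟨hxN, hx0, hxo, hx1, hx2, hx3⟩ y ⟨hyN, hy0, hyo, -, -, -⟩ hx hy
    have hdvd := (ZMod.intCast_zmod_eq_zero_iff_dvd _ p).1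
      (hx.inner_eq_zero hι h2 (projRep_ne_zero t) hy)
    have hodd : Odd (x.1 * y.1 + x.2.1 * y.2.1 + x.2.2.1 * y.2.2.1 + x.2.2.2 * y.2.2.2) :=
      (((hxo.mul hyo).add_even (hx1.mul_right _)).add_even (hx2.mul_right _)).add_even
        (hx3.mul_right _)
    refine (eq_or_eq_neg_of_dvd_inner hxN hyN hdvd ?_).resolve_right ?_
    · intro h
      simp [h] at hodd
    · rintro rfl
      simp only [Prod.fst_neg] at hx0
      omega
  have hproj : ∀ x ∈ S, ∃! t : Option (ZMod p), AnnihilatesVec ι (projRep t) x := by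
    rintro x ⟨hN, -⟩
    refine existsUnique_annihilatesVec_projRep hι h2 (by simp [quadNorm, hN]) ?_
    simp only [ZMod.intCast_zmod_eq_zero_iff_dvd]
    rintro ⟨⟨a, ha⟩, ⟨b, hb⟩, ⟨c, hc⟩, ⟨d, hd⟩⟩
    rw [ha, hb, hc, hd] at hN
    have hp1 : (1 : ℤ) < p := by exact_mod_cast hp.one_lt
    have : (p : ℤ) * (a ^ 2 + b ^ 2 + c ^ 2 + d ^ 2) = 1 :=
      mul_left_cancel₀ (by omega : (p : ℤ) ≠ 0) (by linear_combination hN)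
    have := Int.le_of_dvd one_pos ⟨_, this.symm⟩
    omega
  choose f hfS hf using hex
  have hinj : Function.Injective f := fun s t hst ↦
    (hproj _ (hfS s)).unique (hf s) (hst ▸ hf t)
  have hrange : S = Set.range f := by
    refine Set.Subset.antisymm (fun x hx ↦ ?_) (Set.range_subset_iff.2 hfS)
    obtain ⟨t, ht, -⟩ := hproj x hx
    exact ⟨t, hunique t _ (hfS t) _ hx (hf t) ht⟩
  rw [hrange, ← Nat.card_coe_set_eq, Nat.card_range_of_injective hinj, Nat.card_eq_fintype_card,
    Fintype.card_option, ZMod.card]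
end

section
/- Let G be a connected k-regular Ramanujan graph with simple trivial eigenvalue on n vertices (k ≥ 3), let ε > 0 be real, and let R be a natural number with R > (1+ε)·log n / log(k−1). Then for every vertex x, the number of vertices y whose graph distance from x exceeds R is at most n^{1−ε}·(1+R)². In particular, the distance between all but a vanishing fraction of pairs of vertices is less than (1+ε)·log_{k−1} n. -/
/-- The value at `t` of the rescaled Chebyshev polynomial of the second kind
`q ^ (m / 2) * U m (t / (2 √q))`. -/
def scaledChebyshev (q t : ℝ) : ℕ → ℝ
  | 0 => 1
  | 1 => t
  | m + 2 => t * scaledChebyshev q t (m + 1) - q * scaledChebyshev q t m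

/-- The rescaled Chebyshev polynomial of the second kind of the matrix `A`, applied to `v`. -/
def scaledChebyshevMulVec {V : Type*} [Fintype V] (A : Matrix V V ℝ) (q : ℝ) (v : V → ℝ) :
    ℕ → V → ℝ
  | 0 => v
  | 1 => A.mulVec v
  | m + 2 => A.mulVec (scaledChebyshevMulVec A q v (m + 1)) - q • scaledChebyshevMulVec A q v m

lemma scaledChebyshev_cos (s θ : ℝ) (m : ℕ) :
    Real.sin θ * scaledChebyshev (s ^ 2) (2 * s * Real.cos θ) m
        = s ^ m * Real.sin ((m + 1) * θ) ∧
      scaledChebyshev (s ^ 2) (2 * s * Real.cos θ) (m + 1)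
        = s * Real.cos θ * scaledChebyshev (s ^ 2) (2 * s * Real.cos θ) m
          + s ^ (m + 1) * Real.cos ((m + 1) * θ) := by
  induction m with
  | zero => simp [scaledChebyshev]; ring
  | succ m ih =>
    obtain ⟨hsin, hcos⟩ := ih
    have hθ : ((m + 1 : ℕ) + 1 : ℝ) * θ = (m + 1) * θ + θ := by push_cast; ring
    rw [hθ, Real.sin_add, Real.cos_add]
    constructor
    · rw [hcos]
      linear_combination s * Real.cos θ * hsin
    · rw [scaledChebyshev]
      linear_combination s * Real.cos θ * hcos - s ^ 2 * Real.sin θ * hsin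
        + s ^ 2 * scaledChebyshev (s ^ 2) (2 * s * Real.cos θ) m * Real.sin_sq_add_cos_sq θ

lemma abs_scaledChebyshev_le {s t : ℝ} (hs : 0 < s) (ht : |t| ≤ 2 * s) (m : ℕ) :
    |scaledChebyshev (s ^ 2) t m| ≤ (m + 1) * s ^ m := by
  obtain ⟨h₁, h₂⟩ := abs_le.mp ht
  have hcos : 2 * s * Real.cos (Real.arccos (t / (2 * s))) = t := by
    rw [Real.cos_arccos]
    · field_simp
    · rw [le_div_iff₀ (by positivity)]; linarith
    · rw [div_le_iff₀ (by positivity)]; linarith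
  set θ := Real.arccos (t / (2 * s))
  rw [← hcos]
  induction m with
  | zero => simp [scaledChebyshev]
  | succ m ih =>
    rw [(scaledChebyshev_cos s θ m).2]
    refine (abs_add_le _ _).trans ?_
    rw [abs_mul, abs_mul, abs_mul, abs_of_pos hs, abs_of_pos (pow_pos hs (m + 1))]
    calc s * |Real.cos θ| * |scaledChebyshev (s ^ 2) (2 * s * Real.cos θ) m|
          + s ^ (m + 1) * |Real.cos ((m + 1) * θ)|
        ≤ s * 1 * ((m + 1) * s ^ m) + s ^ (m + 1) * 1 := by
          gcongr <;> exact Real.abs_cos_le_one _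
      _ = ((m + 1 : ℕ) + 1) * s ^ (m + 1) := by push_cast; ring

lemma scaledChebyshev_add_one_succ (q : ℝ) (m : ℕ) :
    scaledChebyshev q (q + 1) (m + 1) = q * scaledChebyshev q (q + 1) m + 1 := by
  induction m with
  | zero => simp [scaledChebyshev]
  | succ m ih =>
    rw [scaledChebyshev]
    linear_combination ih

lemma pow_le_scaledChebyshev_add_one {q : ℝ} (hq : 0 ≤ q) (m : ℕ) :
    q ^ m ≤ scaledChebyshev q (q + 1) m := by
  induction m with
  | zero => simp [scaledChebyshev]
  | succ m ih =>
    rw [scaledChebyshev_add_one_succ, pow_succ']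
    linarith [mul_le_mul_of_nonneg_left ih hq]

lemma dotProduct_scaledChebyshevMulVec {V : Type*} [Fintype V] {A : Matrix V V ℝ}
    (hA : A.transpose = A) {u : V → ℝ} {t : ℝ} (hu : A.mulVec u = t • u) (q : ℝ) (v : V → ℝ)
    (m : ℕ) :
    u ⬝ᵥ scaledChebyshevMulVec A q v m = scaledChebyshev q t m * (u ⬝ᵥ v) := by
  have key (w : V → ℝ) : u ⬝ᵥ A.mulVec w = t * (u ⬝ᵥ w) := by
    rw [Matrix.dotProduct_mulVec, ← Matrix.mulVec_transpose, hA, hu, smul_dotProduct, smul_eq_mul]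
  induction m using Nat.twoStepInduction with
  | zero => simp [scaledChebyshev, scaledChebyshevMulVec]
  | one => simp [scaledChebyshev, scaledChebyshevMulVec, key]
  | more m ih₁ ih₂ =>
    rw [scaledChebyshev, scaledChebyshevMulVec, dotProduct_sub, key, dotProduct_smul, ih₁, ih₂,
      smul_eq_mul]
    ring

lemma SimpleGraph.Connected.scaledChebyshevMulVec_adjMatrix_eq_zero {V : Type*} [Fintype V]
    [DecidableEq V] {G : SimpleGraph V} [DecidableRel G.Adj] (hconn : G.Connected) (q : ℝ)
    (x : V) (m : ℕ) {y : V} (hy : m < G.dist x y) :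
    scaledChebyshevMulVec (G.adjMatrix ℝ) q (Pi.single x 1) m y = 0 := by
  have lt_of_adj {m : ℕ} {y z : V} (hy : m + 1 < G.dist x y) (hz : G.Adj y z) :
      m < G.dist x z := by
    have h₁ := hconn.dist_triangle (u := x) (v := z) (w := y)
    have h₂ := SimpleGraph.dist_eq_one_iff_adj.mpr hz.symm
    omega
  have h_single {y : V} (hy : 0 < G.dist x y) : (Pi.single x 1 : V → ℝ) y = 0 :=
    Pi.single_eq_of_ne (by rintro rfl; simp at hy) _
  induction m using Nat.twoStepInduction generalizing y with
  | zero => exact h_single hy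
  | one =>
    rw [scaledChebyshevMulVec, SimpleGraph.adjMatrix_mulVec_apply]
    exact Finset.sum_eq_zero fun z hz ↦
      h_single (lt_of_adj hy ((G.mem_neighborFinset y z).mp hz))
  | more m ih₁ ih₂ =>
    rw [scaledChebyshevMulVec, Pi.sub_apply, Pi.smul_apply, ih₁ (by omega), smul_zero, sub_zero,
      SimpleGraph.adjMatrix_mulVec_apply]
    exact Finset.sum_eq_zero fun z hz ↦
      ih₂ (lt_of_adj hy ((G.mem_neighborFinset y z).mp hz))

lemma OrthonormalBasis.sum_dotProduct_sq {ι V : Type*} [Fintype ι] [Fintype V]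
    (b : OrthonormalBasis ι ℝ (EuclideanSpace ℝ V)) (v : V → ℝ) :
    ∑ j, ((b j).ofLp ⬝ᵥ v) ^ 2 = v ⬝ᵥ v := by
  have h := b.sum_sq_norm_inner_right (WithLp.toLp 2 v)
  rw [EuclideanSpace.real_norm_sq_eq] at h
  simpa [PiLp.inner_apply, dotProduct, mul_comm, sq] using h

lemma Matrix.IsHermitian.transpose_eq {V : Type*} {A : Matrix V V ℝ} (hA : A.IsHermitian) :
    A.transpose = A := by
  rw [← Matrix.conjTranspose_eq_transpose_of_trivial, hA.eq]

lemma Matrix.IsHermitian.eigenvectorBasis_dotProduct_one_eq_zero {V : Type*} [Fintype V]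
    [DecidableEq V] {A : Matrix V V ℝ} (hA : A.IsHermitian) {d : ℝ}
    (hd : A.mulVec 1 = d • (1 : V → ℝ)) {j : V} (hj : hA.eigenvalues j ≠ d) :
    (hA.eigenvectorBasis j).ofLp ⬝ᵥ (1 : V → ℝ) = 0 := by
  have h := Matrix.dotProduct_mulVec (hA.eigenvectorBasis j).ofLp A 1
  rw [← Matrix.mulVec_transpose, hA.transpose_eq, hA.mulVec_eigenvectorBasis, smul_dotProduct,
    hd, dotProduct_smul, smul_eq_mul, smul_eq_mul] at h
  exact (mul_eq_mul_right_iff.mp h).resolve_left hj.symm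

/-- If `A` has constant row sums `d` and `d` is a simple eigenvalue, then the corresponding unit
eigenvector is orthogonal to every vector of sum zero. -/
lemma Matrix.IsHermitian.eigenvectorBasis_dotProduct_eq_zero {V : Type*} [Fintype V]
    [DecidableEq V] {A : Matrix V V ℝ} (hA : A.IsHermitian) {d : ℝ}
    (hd : A.mulVec 1 = d • (1 : V → ℝ)) {j₀ : V} (hsimple : ∀ j ≠ j₀, hA.eigenvalues j ≠ d)
    {w : V → ℝ} (hw : 1 ⬝ᵥ w = 0) : (hA.eigenvectorBasis j₀).ofLp ⬝ᵥ w = 0 := by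
  set b := hA.eigenvectorBasis
  have h_orth (j : V) (hj : j ≠ j₀) : (b j).ofLp ⬝ᵥ (1 : V → ℝ) = 0 :=
    hA.eigenvectorBasis_dotProduct_one_eq_zero hd (hsimple j hj)
  have h_repr := b.sum_repr' (WithLp.toLp 2 (1 : V → ℝ))
  have h_inner (j : V) : inner ℝ (b j) (WithLp.toLp 2 (1 : V → ℝ)) = (b j).ofLp ⬝ᵥ 1 := by
    simp [PiLp.inner_apply, dotProduct]
  simp_rw [h_inner] at h_repr
  rw [Finset.sum_eq_single j₀ (fun j _ hj ↦ by rw [h_orth j hj, zero_smul]) (by simp)] at h_repr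
  have h_one : ((b j₀).ofLp ⬝ᵥ (1 : V → ℝ)) • (b j₀).ofLp = 1 := congrArg WithLp.ofLp h_repr
  rw [← h_one, smul_dotProduct, smul_eq_mul] at hw
  refine (mul_eq_zero.mp hw).resolve_left fun h ↦ ?_
  rw [h, zero_smul] at h_one
  exact zero_ne_one (congrFun h_one j₀)

lemma Matrix.IsHermitian.dotProduct_scaledChebyshevMulVec_sub_le {V : Type*} [Fintype V]
    [DecidableEq V] {A : Matrix V V ℝ} (hA : A.IsHermitian) {s : ℝ} (hs : 1 < s)
    (hd : A.mulVec 1 = (s ^ 2 + 1) • (1 : V → ℝ)) {j₀ : V}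
    (hram : ∀ j ≠ j₀, |hA.eigenvalues j| ≤ 2 * s) (x : V) (m : ℕ) {w : V → ℝ}
    (hw : w = scaledChebyshevMulVec A (s ^ 2) (Pi.single x 1) m
      - (scaledChebyshev (s ^ 2) (s ^ 2 + 1) m / Fintype.card V) • (1 : V → ℝ)) :
    w ⬝ᵥ w ≤ ((m + 1) * s ^ m) ^ 2 := by
  have hsimple : ∀ j ≠ j₀, hA.eigenvalues j ≠ s ^ 2 + 1 := by
    intro j hj h
    have := (le_abs_self _).trans (hram j hj)
    nlinarith
  have : Nonempty V := ⟨x⟩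
  have hn : (Fintype.card V : ℝ) ≠ 0 := by simp
  have h_sum : (1 : V → ℝ) ⬝ᵥ w = 0 := by
    rw [hw, dotProduct_sub, dotProduct_scaledChebyshevMulVec hA.transpose_eq hd, dotProduct_smul]
    simp [hn]
  set b := hA.eigenvectorBasis
  have h_coeff (j : V) : ((b j).ofLp ⬝ᵥ w) ^ 2
      ≤ ((m + 1) * s ^ m) ^ 2 * ((b j).ofLp ⬝ᵥ Pi.single x 1) ^ 2 := by
    by_cases hj : j = j₀
    · rw [hj, hA.eigenvectorBasis_dotProduct_eq_zero hd hsimple h_sum, zero_pow two_ne_zero]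
      positivity
    · rw [hw, dotProduct_sub, dotProduct_smul,
        hA.eigenvectorBasis_dotProduct_one_eq_zero hd (hsimple j hj), smul_zero, sub_zero,
        dotProduct_scaledChebyshevMulVec hA.transpose_eq (hA.mulVec_eigenvectorBasis j), mul_pow]
      have := abs_scaledChebyshev_le (zero_lt_one.trans hs) (hram j hj) m
      rw [← sq_abs (scaledChebyshev _ _ _)]
      gcongr
  calc w ⬝ᵥ w = ∑ j, ((b j).ofLp ⬝ᵥ w) ^ 2 := (b.sum_dotProduct_sq w).symm
    _ ≤ ∑ j, ((m + 1) * s ^ m) ^ 2 * ((b j).ofLp ⬝ᵥ Pi.single x 1) ^ 2 :=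
      Finset.sum_le_sum fun j _ ↦ h_coeff j
    _ = ((m + 1) * s ^ m) ^ 2 := by
      rw [← Finset.mul_sum, b.sum_dotProduct_sq]
      simp

/-- Let `G` be a connected `k`-regular Ramanujan graph (with simple
trivial eigenvalue `k`) on `n` vertices, `k ≥ 3`, let `ε > 0`, and let `R` be a
natural number with `R > (1+ε)·log n / log(k−1)`, i.e. `R > (1+ε)·log_{k-1} n`. Then
for every vertex `x`, the number of vertices `y` whose graph distance from `x`
exceeds `R` is at most `n^{1−ε}·(1+R)²`. -/
theorem ramanujan_almost_all_distances_small
    {V : Type*} [Fintype V] [DecidableEq V]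
    (G : SimpleGraph V) [DecidableRel G.Adj] (hconn : G.Connected)
    (k : ℕ) (hk : 3 ≤ k) (hreg : G.IsRegularOfDegree k)
    (hA : (G.adjMatrix ℝ).IsHermitian)
    (j₀ : V) (hj₀ : hA.eigenvalues j₀ = k)
    (hram : ∀ j ≠ j₀, |hA.eigenvalues j| ≤ 2 * Real.sqrt ((k : ℝ) - 1))
    (ε : ℝ) (hε : 0 < ε) (R : ℕ)
    (hR : (R : ℝ) > (1 + ε) * Real.log (Fintype.card V) / Real.log ((k : ℝ) - 1))
    (x : V) :
    ({y : V | R < G.dist x y}.ncard : ℝ)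
      ≤ (Fintype.card V : ℝ) ^ ((1 : ℝ) - ε) * (1 + (R : ℝ)) ^ 2 := by
  classical
  obtain ⟨q, hq, hq2⟩ : ∃ q : ℝ, (k : ℝ) - 1 = q ∧ 2 ≤ q :=
    ⟨_, rfl, by have : (3 : ℝ) ≤ k := by exact_mod_cast hk
                linarith⟩
  rw [hq] at hram hR
  have hs2 : √q ^ 2 = q := Real.sq_sqrt (by linarith)
  have hs : 1 < √q := Real.lt_sqrt_of_sq_lt (by linarith)
  have hd : (G.adjMatrix ℝ).mulVec 1 = (√q ^ 2 + 1) • (1 : V → ℝ) := by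
    ext y
    simp only [SimpleGraph.adjMatrix_mulVec_apply, Pi.one_apply, Finset.sum_const,
      SimpleGraph.card_neighborFinset_eq_degree, hreg y, Pi.smul_apply, hs2, nsmul_eq_mul,
      smul_eq_mul, mul_one]
    linarith
  have h_norm := hA.dotProduct_scaledChebyshevMulVec_sub_le hs hd hram x R rfl
  rw [hs2, mul_pow, ← pow_mul, mul_comm R 2, pow_mul, hs2] at h_norm
  have : Nonempty V := ⟨x⟩
  have hn : (0 : ℝ) < Fintype.card V := by exact_mod_cast Fintype.card_pos
  set n := (Fintype.card V : ℝ)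
  set S := scaledChebyshev q (q + 1) R
  have hS : q ^ R ≤ S := pow_le_scaledChebyshev_add_one (by linarith) R
  have hqR : 0 < q ^ R := by positivity
  set N : ℝ := ({y : V | R < G.dist x y}.ncard : ℝ) with hN
  have h_far : N * (S / n) ^ 2 ≤ (R + 1) ^ 2 * q ^ R := by
    refine le_trans ?_ h_norm
    rw [hN, Set.ncard_eq_toFinset_card', ← nsmul_eq_mul, ← Finset.sum_const]
    refine le_trans (Finset.sum_le_sum fun y hy ↦ ?_)
      (Finset.sum_le_univ_sum_of_nonneg fun y ↦ mul_self_nonneg _)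
    have hy' : R < G.dist x y := by simpa using hy
    simp [hconn.scaledChebyshevMulVec_adjMatrix_eq_zero q x R hy', sq]
  have h_pow : n ^ (1 + ε) ≤ q ^ R := by
    have hlog : 0 < Real.log q := Real.log_pos (by linarith)
    rw [gt_iff_lt, div_lt_iff₀ hlog] at hR
    rw [← Real.log_le_log_iff (by positivity) hqR, Real.log_rpow hn, Real.log_pow]
    exact hR.le
  have h_split : n ^ (1 - ε) * n ^ (1 + ε) = n ^ 2 := by
    rw [← Real.rpow_add hn, ← Real.rpow_natCast]
    norm_num
  have h_count : N * q ^ R ≤ (R + 1) ^ 2 * n ^ 2 := by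
    refine le_of_mul_le_mul_right ?_ hqR
    calc N * q ^ R * q ^ R = N * (q ^ R / n) ^ 2 * n ^ 2 := by field_simp
      _ ≤ N * (S / n) ^ 2 * n ^ 2 := by gcongr
      _ ≤ (R + 1) ^ 2 * q ^ R * n ^ 2 := by gcongr
      _ = (R + 1) ^ 2 * n ^ 2 * q ^ R := by ring
  refine le_of_mul_le_mul_right ?_ hqR
  calc N * q ^ R ≤ (R + 1) ^ 2 * n ^ 2 := h_count
    _ = n ^ (1 - ε) * (1 + R) ^ 2 * n ^ (1 + ε) := by rw [← h_split]; ring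
    _ ≤ n ^ (1 - ε) * (1 + R) ^ 2 * q ^ R := by gcongr
end

section
/- Let p and q be primes with p ≡ 1 (mod 4), q ≡ 1 (mod 4), and p a quadratic non-residue modulo q. In the bipartite LPS Ramanujan graph X_{p,q} on PGL₂(ZMod q), the graph distance d between the class of the identity matrix and the class W̄ of the matrix ![![0,1],![−1,0]] satisfies (d : ℝ) ≥ log_p(q⁴/4). Consequently the diameter of X_{p,q} satisfies (diam : ℝ) ≥ (4/3)·log_p((q³−q)/2) − (2/3)·log_p(2). -/
open Matrix

open Quaternion

/-- Reduction theory of positive definite ternary forms of determinant one: an integer represented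
by such a form is a sum of three squares. -/
theorem sum_three_sq_of_unimodular_form (N : ℤ) (n m : ℕ) :
    ∀ a b c d e g : ℤ, a = n → a * d - b ^ 2 = m → 0 < a → 0 < a * d - b ^ 2 →
      a * (d * g - e ^ 2) - b * (b * g - c * e) + c * (b * e - c * d) = 1 →
      (∃ x y z : ℤ, a * x ^ 2 + 2 * b * x * y + 2 * c * x * z + d * y ^ 2 + 2 * e * y * z
        + g * z ^ 2 = N) →
      ∃ x y z : ℤ, x ^ 2 + y ^ 2 + z ^ 2 = N := by
  induction n using Nat.strong_induction_on generalizing m with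
  | _ n ihn =>
  induction m using Nat.strong_induction_on with
  | _ m ihm =>
  have reduced : ∀ a b c d e g : ℤ, a = n → a * d - b ^ 2 = m → 0 < a → 0 < a * d - b ^ 2 →
      a * (d * g - e ^ 2) - b * (b * g - c * e) + c * (b * e - c * d) = 1 →
      (∃ x y z : ℤ, a * x ^ 2 + 2 * b * x * y + 2 * c * x * z + d * y ^ 2 + 2 * e * y * z
        + g * z ^ 2 = N) → |2 * b| ≤ a → |2 * (a * e - b * c)| ≤ a * d - b ^ 2 →
      ∃ x y z : ℤ, x ^ 2 + y ^ 2 + z ^ 2 = N := by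
    intro a b c d e g han hAm ha hA hdet ⟨x, y, z, hN⟩ hb hB
    rcases lt_or_ge d a with hda | hda
    · have hd : 0 < d := by
        by_contra! h
        nlinarith [sq_nonneg b, mul_nonneg ha.le (neg_nonneg.2 h)]
      refine ihn d.toNat (by omega) m d b e a c g (by omega) (by linarith) hd (by linarith)
        (by linarith) ⟨y, x, z, by linarith⟩
    rcases lt_or_ge (a * g - c ^ 2) (a * d - b ^ 2) with hC | hC
    · have hC0 : 0 < a * g - c ^ 2 := by
        have : 0 < (a * d - b ^ 2) * (a * g - c ^ 2) := by
          have : (a * d - b ^ 2) * (a * g - c ^ 2) = a + (a * e - b * c) ^ 2 := by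
            linear_combination a * hdet
          rw [this]; positivity
        exact pos_of_mul_pos_right this hA.le
      exact ihm (a * g - c ^ 2).toNat (by omega) a c b g e d han (by omega) ha hC0
        (by linarith) ⟨x, z, y, by linarith⟩
    have hBC : (a * d - b ^ 2) * (a * g - c ^ 2) = a + (a * e - b * c) ^ 2 := by
      linear_combination a * hdet
    generalize hA' : a * d - b ^ 2 = A at *
    generalize hB' : a * e - b * c = B at *
    have hb2 : 4 * b ^ 2 ≤ a ^ 2 := by
      have := sq_le_sq' (abs_le.1 hb).1 (abs_le.1 hb).2; linarith
    have hB2 : 4 * B ^ 2 ≤ A ^ 2 := by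
      have := sq_le_sq' (abs_le.1 hB).1 (abs_le.1 hB).2; linarith
    have h1 : 3 * A ^ 2 ≤ 4 * a := by nlinarith
    have h2 : 3 * a ^ 2 ≤ 4 * A := by nlinarith
    have ha1 : a = 1 := by nlinarith
    subst ha1
    have hA1 : A = 1 := by nlinarith
    subst hA1
    have hb0 : b = 0 := by rw [abs_le] at hb; omega
    have hB0 : B = 0 := by rw [abs_le] at hB; omega
    subst hb0 hB0
    exact ⟨x + c * z, y, z, by
      have hd : d = 1 := by linarith
      have he : e = 0 := by linarith
      subst hd he
      linear_combination hN - z ^ 2 * hBC⟩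
  have hround : ∀ u v : ℤ, 0 < v → ∃ t : ℤ, |2 * (u + t * v)| ≤ v := by
    intro u v hv
    refine ⟨-((2 * u + v) / (2 * v)), ?_⟩
    have h1 := Int.emod_add_mul_ediv (2 * u + v) (2 * v)
    have h2 := Int.emod_nonneg (2 * u + v) (b := 2 * v) (by omega)
    have h3 := Int.emod_lt_of_pos (2 * u + v) (b := 2 * v) (by omega)
    rw [abs_le]
    constructor <;> linarith
  intro a b c d e g han hAm ha hA hdet ⟨x, y, z, hN⟩
  obtain ⟨t, ht⟩ := hround b a ha
  obtain ⟨r, hr⟩ := hround (a * e - b * c) _ hA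
  refine reduced a (b + t * a) (c + r * (b + t * a)) (d + 2 * t * b + t ^ 2 * a)
    (e + t * c + r * (d + 2 * t * b + t ^ 2 * a))
    (g + 2 * r * (e + t * c) + r ^ 2 * (d + 2 * t * b + t ^ 2 * a)) han ?_ ha ?_ ?_
    ⟨x - t * y, y - r * z, z, ?_⟩ ht ?_
  · linarith
  · linarith
  · linarith
  · linarith
  · rwa [show a * (d + 2 * t * b + t ^ 2 * a) - (b + t * a) ^ 2 = a * d - b ^ 2 by ring,
      show a * (e + t * c + r * (d + 2 * t * b + t ^ 2 * a)) - (b + t * a) * (c + r * (b + t * a))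
        = a * e - b * c + r * (a * d - b ^ 2) by ring]

theorem Int.exists_sum_three_sq_of_emod_four_eq_two {N : ℤ} (hN : 0 < N) (h : N % 4 = 2) :
    ∃ x y z : ℤ, x ^ 2 + y ^ 2 + z ^ 2 = N := by
  lift N to ℕ using hN.le
  have hN' : N % 4 = 2 := by omega
  have hcop : (N - 1).Coprime (4 * N) := by
    refine Nat.Coprime.mul_right ?_ ?_
    · rw [show 4 = 2 ^ 2 by norm_num]
      exact Nat.Coprime.pow_right 2 (Nat.coprime_two_right.2 (by rw [Nat.odd_iff]; omega))
    · exact (Nat.coprime_self_sub_left (by omega)).2 (Nat.coprime_one_left N)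
  obtain ⟨P, hPN, hP, hPmod⟩ := Nat.forall_exists_prime_gt_and_modEq (4 * N) (q := 4 * N)
    (a := N - 1) (by omega) hcop
  have := Fact.mk hP
  obtain ⟨v, hv⟩ : ∃ v, P = N - 1 + 4 * N * v := by
    obtain ⟨v, hv⟩ := (Nat.modEq_iff_dvd' (by omega)).1 hPmod.symm
    exact ⟨v, by omega⟩
  have hP' : P + 1 = N * (4 * v + 1) := by
    have : N * (4 * v + 1) = 4 * N * v + N := by ring
    omega
  have hP4 : P % 4 = 1 := by
    rw [hv, mul_assoc, Nat.add_mul_mod_self_left]; omega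
  have hJ : jacobiSym (4 * v + 1 : ℕ) P = 1 := by
    rw [← jacobiSym.quadratic_reciprocity_one_mod_four hP4 (by rw [Nat.odd_iff]; omega)]
    rw [jacobiSym.mod_left' (a₂ := -1)]
    · rw [jacobiSym.at_neg_one (by rw [Nat.odd_iff]; omega), ZMod.χ₄_nat_one_mod_four (by omega)]
    · exact (Int.modEq_iff_dvd.2 ⟨N, by push_cast; zify at hP'; linarith⟩).symm
  have hsq : IsSquare (-((4 * v + 1 : ℕ) : ℤ) : ZMod P) := by
    have h1 : IsSquare (-1 : ZMod P) := ZMod.exists_sq_eq_neg_one_iff.2 (by omega)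
    have h2 := ZMod.isSquare_of_jacobiSym_eq_one hJ
    simpa using h1.mul h2
  obtain ⟨b, hb⟩ := hsq
  obtain ⟨b, rfl⟩ := ZMod.intCast_surjective b
  obtain ⟨a, ha⟩ : (P : ℤ) ∣ (4 * v + 1 : ℕ) + b ^ 2 := by
    rw [← ZMod.intCast_zmod_eq_zero_iff_dvd]
    push_cast at hb ⊢
    linear_combination -hb
  have hP0 : (0 : ℤ) < P := by exact_mod_cast hP.pos
  have hpos : (0 : ℤ) < (4 * v + 1 : ℕ) + b ^ 2 := by positivity
  have ha0 : 0 < a := pos_of_mul_pos_right (ha ▸ hpos) hP0.le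
  have hA : a * P - b ^ 2 = (4 * v + 1 : ℕ) := by linarith
  have hPZ : (P : ℤ) + 1 = N * (4 * v + 1 : ℕ) := by exact_mod_cast hP'
  refine sum_three_sq_of_unimodular_form N a.toNat (4 * v + 1) a b 1 P 0 N (by omega) hA ha0
    (by rw [hA]; positivity) ?_ ⟨0, 0, 1, by ring⟩
  linear_combination (N : ℤ) * hA - hPZ

/-- An integral quaternion with odd real part and even imaginary coordinates. -/
def IsOddRealEvenIm (x : ℍ[ℤ]) : Prop :=
  Odd x.re ∧ Even x.imI ∧ Even x.imJ ∧ Even x.imK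

/-- The integral quaternions indexing the generators of the LPS graph. -/
def IsLPSGenerator (p : ℕ) (s : ℍ[ℤ]) : Prop :=
  normSq s = p ∧ 0 < s.re ∧ IsOddRealEvenIm s

theorem IsOddRealEvenIm.mul {x y : ℍ[ℤ]} (hx : IsOddRealEvenIm x) (hy : IsOddRealEvenIm y) :
    IsOddRealEvenIm (x * y) := by
  simp only [IsOddRealEvenIm, ← Int.not_even_iff_odd] at *
  obtain ⟨h0, h1, h2, h3⟩ := hx
  obtain ⟨k0, k1, k2, k3⟩ := hy
  simp [*, parity_simps]

theorem IsOddRealEvenIm.of_mul_left {x y : ℍ[ℤ]} (hx : IsOddRealEvenIm x)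
    (hxy : IsOddRealEvenIm (x * y)) : IsOddRealEvenIm y := by
  simp only [IsOddRealEvenIm, ← Int.not_even_iff_odd] at *
  obtain ⟨h0, h1, h2, h3⟩ := hx
  simpa [h0, h1, h2, h3, parity_simps] using hxy

/-- The integral quaternion `a + b i + c j + d k`. -/
def Quaternion.ofCoords (a b c d : ℤ) : ℍ[ℤ] := ⟨a, b, c, d⟩

section ofCoords

variable (a b c d : ℤ)

@[simp] theorem Quaternion.re_ofCoords : (ofCoords a b c d).re = a := rfl

@[simp] theorem Quaternion.imI_ofCoords : (ofCoords a b c d).imI = b := rfl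

@[simp] theorem Quaternion.imJ_ofCoords : (ofCoords a b c d).imJ = c := rfl

@[simp] theorem Quaternion.imK_ofCoords : (ofCoords a b c d).imK = d := rfl

theorem Quaternion.normSq_ofCoords :
    normSq (ofCoords a b c d) = a ^ 2 + b ^ 2 + c ^ 2 + d ^ 2 := normSq_def' _

end ofCoords

section intSMul

variable (m : ℤ) (x : ℍ[ℤ])

theorem Quaternion.re_int_smul : (m • x).re = m * x.re := rfl

theorem Quaternion.imI_int_smul : (m • x).imI = m * x.imI := rfl

theorem Quaternion.imJ_int_smul : (m • x).imJ = m * x.imJ := rfl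

theorem Quaternion.imK_int_smul : (m • x).imK = m * x.imK := rfl

end intSMul

theorem IsOddRealEvenIm.star {x : ℍ[ℤ]} (hx : IsOddRealEvenIm x) :
    IsOddRealEvenIm (star x) := by
  simpa [IsOddRealEvenIm] using hx

theorem IsLPSGenerator.star {p : ℕ} {s : ℍ[ℤ]} (hs : IsLPSGenerator p s) :
    IsLPSGenerator p (star s) :=
  ⟨by rw [normSq_star, hs.1], by simpa using hs.2.1, hs.2.2.star⟩

theorem Quaternion.exists_eq_smul_of_smul_eq_smul {m p : ℤ} (h : IsCoprime m p) {a b : ℍ[ℤ]}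
    (hab : m • a = p • b) : ∃ c, a = p • c := by
  obtain ⟨u, v, huv⟩ := h
  refine ⟨u • b + v • a, ?_⟩
  calc a = (u * m + v * p) • a := by rw [huv, one_smul]
    _ = u • (m • a) + p • (v • a) := by module
    _ = p • (u • b + v • a) := by rw [hab]; module

theorem Quaternion.exists_mul_eq_two_smul {s : ℍ[ℤ]} (h : Even (normSq s)) :
    ∃ u r : ℍ[ℤ], s * u = (2 : ℤ) • r ∧ normSq u = 2 := by
  have hpar : Even (s.re + s.imI + s.imJ + s.imK) := by
    simpa [normSq_def', parity_simps] using h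
  by_cases hab : Even (s.re + s.imI)
  · obtain ⟨e, he⟩ := hab
    obtain ⟨f, hf⟩ : Even (s.imJ + s.imK) := by grind
    refine ⟨ofCoords 1 1 0 0, ofCoords (e - s.imI) e f (f - s.imJ), ?_,
      by simp [normSq_ofCoords]⟩
    ext <;> simp only [re_mul, imI_mul, imJ_mul, imK_mul, re_int_smul, imI_int_smul,
      imJ_int_smul, imK_int_smul, re_ofCoords, imI_ofCoords, imJ_ofCoords, imK_ofCoords] <;>
      linarith
  by_cases hac : Even (s.re + s.imJ)
  · obtain ⟨e, he⟩ := hac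
    obtain ⟨f, hf⟩ : Even (s.imI + s.imK) := by grind
    refine ⟨ofCoords 1 0 1 0, ofCoords (e - s.imJ) (f - s.imK) e f, ?_,
      by simp [normSq_ofCoords]⟩
    ext <;> simp only [re_mul, imI_mul, imJ_mul, imK_mul, re_int_smul, imI_int_smul,
      imJ_int_smul, imK_int_smul, re_ofCoords, imI_ofCoords, imJ_ofCoords, imK_ofCoords] <;>
      linarith
  · obtain ⟨e, he⟩ : Even (s.re + s.imK) := by grind
    obtain ⟨f, hf⟩ : Even (s.imI + s.imJ) := by grind
    refine ⟨ofCoords 1 0 0 1, ofCoords (e - s.imK) f (f - s.imI) e, ?_,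
      by simp [normSq_ofCoords]⟩
    ext <;> simp only [re_mul, imI_mul, imJ_mul, imK_mul, re_int_smul, imI_int_smul,
      imJ_int_smul, imK_int_smul, re_ofCoords, imI_ofCoords, imJ_ofCoords, imK_ofCoords] <;>
      linarith

theorem Quaternion.exists_add_smul_normSq_lt {m : ℤ} (hm : 0 < m) (hodd : Odd m) (s : ℍ[ℤ]) :
    ∃ r t : ℍ[ℤ], s = r + m • t ∧ normSq r < m ^ 2 := by
  have hround : ∀ a : ℤ, ∃ t, 4 * (a - m * t) ^ 2 < m ^ 2 := by
    intro a
    refine ⟨(2 * a + m) / (2 * m), ?_⟩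
    have h1 := Int.emod_add_mul_ediv (2 * a + m) (2 * m)
    have h2 := Int.emod_nonneg (2 * a + m) (b := 2 * m) (by omega)
    have h3 := Int.emod_lt_of_pos (2 * a + m) (b := 2 * m) (by omega)
    generalize (2 * a + m) / (2 * m) = t at *
    have h4 : 2 * (a - m * t) = (2 * a + m) % (2 * m) - m := by linarith
    have h5 : 2 * (a - m * t) ≠ -m := by obtain ⟨k, hk⟩ := hodd; omega
    have h6 : -m < 2 * (a - m * t) := by omega
    have h7 : 2 * (a - m * t) < m := by omega
    have := sq_lt_sq' h6 h7
    linarith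
  obtain ⟨a, ha⟩ := hround s.re
  obtain ⟨b, hb⟩ := hround s.imI
  obtain ⟨c, hc⟩ := hround s.imJ
  obtain ⟨d, hd⟩ := hround s.imK
  refine ⟨s - m • ofCoords a b c d, ofCoords a b c d, by simp, ?_⟩
  simp only [normSq_def', re_sub, imI_sub, imJ_sub, imK_sub, re_int_smul, imI_int_smul,
    imJ_int_smul, imK_int_smul, re_ofCoords, imI_ofCoords, imJ_ofCoords, imK_ofCoords]
  linarith

theorem Quaternion.dvd_normSq_of_eq_add_smul {m : ℤ} {s r t : ℍ[ℤ]} (h : s = r + m • t)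
    (hs : m ∣ normSq s) : m ∣ normSq r := by
  obtain rfl : r = s - m • t := by simp [h]
  obtain ⟨k, hk⟩ := hs
  simp only [normSq_def', re_sub, imI_sub, imJ_sub, imK_sub, re_int_smul, imI_int_smul,
    imJ_int_smul, imK_int_smul] at hk ⊢
  refine ⟨k + m * (t.re ^ 2 + t.imI ^ 2 + t.imJ ^ 2 + t.imK ^ 2) - 2 * (s.re * t.re +
    s.imI * t.imI + s.imJ * t.imJ + s.imK * t.imK), ?_⟩
  linear_combination hk

/-- Lagrange's descent inside the right ideal of those `s` with `p ∣ star s * x`. -/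
theorem Quaternion.exists_normSq_eq_prime_of_descent {p : ℕ} (hp : p.Prime) (hp2 : p ≠ 2)
    (x : ℍ[ℤ]) (m : ℕ) : ∀ s y : ℍ[ℤ], 0 < m → m < p → normSq s = p * m →
      star s * x = (p : ℤ) • y → ∃ s z : ℍ[ℤ], normSq s = p ∧ x = s * z := by
  induction m using Nat.strong_induction_on with
  | _ m ih =>
  intro s y hm hmp hs hsx
  obtain rfl | hm1 : m = 1 ∨ 1 < m := by omega
  · have hs' : normSq s = p := by simpa using hs
    refine ⟨s, y, hs', ?_⟩
    have hp0 : (p : ℤ) ≠ 0 := by exact_mod_cast hp.ne_zero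
    refine smul_right_injective _ hp0 ?_
    change (p : ℤ) • x = (p : ℤ) • (s * y)
    rw [← mul_smul_comm, ← hsx, ← mul_assoc, self_mul_star, hs', coe_mul_eq_smul]
  have hcop : ∀ k : ℕ, 0 < k → k < p → IsCoprime (k : ℤ) p := fun k hk hkp =>
    Nat.isCoprime_iff_coprime.2 (Nat.coprime_of_lt_prime hk.ne' hkp hp).symm
  rcases Nat.even_or_odd m with ⟨k, hk⟩ | hodd
  · obtain ⟨u, r, hsu, hu⟩ := exists_mul_eq_two_smul (s := s)
      (by rw [hs, hk]; push_cast; exact ⟨p * k, by ring⟩)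
    have h2 : (2 : ℤ) • (star r * x) = (p : ℤ) • (star u * y) := by
      rw [← smul_mul_assoc, ← star_zsmul, ← hsu, star_mul, mul_assoc, hsx, mul_smul_comm]
    obtain ⟨c, hc⟩ := exists_eq_smul_of_smul_eq_smul
      (hcop 2 (by norm_num) (lt_of_le_of_ne hp.two_le hp2.symm)) h2
    refine ih k (by omega) r c (by omega) (by omega) ?_ hc
    have h3 := congrArg normSq hsu
    rw [map_mul, normSq_smul, hs, hu, hk] at h3
    push_cast at h3
    linarith
  · have hm0 : (0 : ℤ) < m := by exact_mod_cast hm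
    obtain ⟨r, t, hrt, hr⟩ := exists_add_smul_normSq_lt hm0 (by exact_mod_cast hodd) s
    obtain ⟨k, hk⟩ := dvd_normSq_of_eq_add_smul hrt (hs ▸ Dvd.intro_left _ rfl)
    have hkm : k < m := by
      rw [hk, sq] at hr; exact lt_of_mul_lt_mul_left hr hm0.le
    have hk0 : 0 < k := by
      refine lt_of_le_of_ne (nonneg_of_mul_nonneg_right (hk ▸ normSq_nonneg) hm0) ?_
      rintro rfl
      rw [mul_zero, normSq_eq_zero] at hk
      rw [hk, zero_add] at hrt
      rw [hrt, normSq_smul] at hs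
      have h4 : (p : ℤ) = m * normSq t := by
        refine mul_left_cancel₀ hm0.ne' ?_
        linarith
      have h5 : m ∣ p := by exact_mod_cast Dvd.intro _ h4.symm
      rcases (Nat.dvd_prime hp).1 h5 with h | h <;> omega
    have hstar : star r = star s - (m : ℤ) • star t := by
      rw [hrt, star_add, star_zsmul, add_sub_cancel_right]
    have hss : s * star r = (m : ℤ) • ((p : ℤ) - s * star t) := by
      rw [hstar, mul_sub, self_mul_star, hs, mul_smul_comm, smul_sub]
      congr 1
      ext <;> simp [mul_comm]
    generalize ((p : ℤ) : ℍ[ℤ]) - s * star t = s' at hss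
    lift k to ℕ using hk0.le
    have h2 : (m : ℤ) • (star s' * x) = (p : ℤ) • (r * y) := by
      rw [← smul_mul_assoc, ← star_zsmul, ← hss, star_mul, star_star, mul_assoc, hsx, mul_smul_comm]
    obtain ⟨c, hc⟩ := exists_eq_smul_of_smul_eq_smul (hcop m hm hmp) h2
    refine ih k (by omega) s' c (by omega) (by omega) ?_ hc
    have h3 := congrArg normSq hss
    rw [map_mul, normSq_smul, hs, normSq_star, hk] at h3
    refine mul_left_cancel₀ (pow_ne_zero 2 hm0.ne') ?_
    linarith

theorem Quaternion.exists_unit_mul_isOddRealEvenIm {p : ℕ} (hp4 : p % 4 = 1) {s : ℍ[ℤ]}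
    (hs : normSq s = p) : ∃ u : ℍ[ℤ], normSq u = 1 ∧ IsLPSGenerator p (s * u) := by
  suffices h : ∃ u : ℍ[ℤ], normSq u = 1 ∧ IsOddRealEvenIm (s * u) by
    obtain ⟨u, hu, h⟩ := h
    rcases lt_trichotomy (s * u).re 0 with h0 | h0 | h0
    · refine ⟨-u, by rw [normSq_neg, hu], ?_, ?_, ?_⟩
      · rw [map_mul, normSq_neg, hs, hu, mul_one]
      · rw [mul_neg, re_neg]; omega
      · rw [mul_neg]
        simpa only [IsOddRealEvenIm, re_neg, imI_neg, imJ_neg, imK_neg, odd_neg, even_neg] using h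
    · have := h.1
      rw [h0] at this
      exact absurd this (by decide)
    · exact ⟨u, hu, by rw [map_mul, hs, hu, mul_one], h0, h⟩
  rw [normSq_def'] at hs
  have hsq : ∀ a : ℤ, Even a ∧ a ^ 2 % 4 = 0 ∨ Odd a ∧ a ^ 2 % 4 = 1 := by
    intro a
    rcases Int.even_or_odd a with h | h
    · exact .inl ⟨h, by obtain ⟨k, rfl⟩ := h; ring_nf; omega⟩
    · exact .inr ⟨h, Int.sq_mod_four_eq_one_of_odd h⟩
  have key : (Odd s.re ∧ Even s.imI ∧ Even s.imJ ∧ Even s.imK) ∨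
      (Odd s.imI ∧ Even s.re ∧ Even s.imJ ∧ Even s.imK) ∨
      (Odd s.imJ ∧ Even s.re ∧ Even s.imI ∧ Even s.imK) ∨
      (Odd s.imK ∧ Even s.re ∧ Even s.imI ∧ Even s.imJ) := by
    rcases hsq s.re with ⟨ha, ha'⟩ | ⟨ha, ha'⟩ <;> rcases hsq s.imI with ⟨hb, hb'⟩ | ⟨hb, hb'⟩ <;>
      rcases hsq s.imJ with ⟨hc, hc'⟩ | ⟨hc, hc'⟩ <;>
      rcases hsq s.imK with ⟨hd, hd'⟩ | ⟨hd, hd'⟩ <;>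
      first | (exfalso; omega) | simp [ha, hb, hc, hd]
  rcases key with ⟨h0, h1, h2, h3⟩ | ⟨h0, h1, h2, h3⟩ | ⟨h0, h1, h2, h3⟩ | ⟨h0, h1, h2, h3⟩
  · exact ⟨1, by simp, by simp [IsOddRealEvenIm, *]⟩
  · exact ⟨ofCoords 0 1 0 0, by simp [normSq_ofCoords], by simp [IsOddRealEvenIm, *]⟩
  · exact ⟨ofCoords 0 0 1 0, by simp [normSq_ofCoords], by simp [IsOddRealEvenIm, *]⟩
  · exact ⟨ofCoords 0 0 0 1, by simp [normSq_ofCoords], by simp [IsOddRealEvenIm, *]⟩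

theorem exists_isLPSGenerator {p : ℕ} (hp4 : p % 4 = 1) :
    ∃ s : ℍ[ℤ], IsLPSGenerator p s := by
  obtain ⟨a, b, c, d, h⟩ := Nat.sum_four_squares p
  obtain ⟨u, -, hu⟩ := Quaternion.exists_unit_mul_isOddRealEvenIm hp4
    (s := Quaternion.ofCoords a b c d) (by rw [Quaternion.normSq_ofCoords]; exact_mod_cast h)
  exact ⟨_, hu⟩

theorem exists_isLPSGenerator_mul_eq {p : ℕ} (hp : p.Prime) (hp4 : p % 4 = 1) {x : ℍ[ℤ]}
    (hx : (p : ℤ) ∣ normSq x) : ∃ s y : ℍ[ℤ], IsLPSGenerator p s ∧ x = s * y := by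
  suffices h : ∃ s z : ℍ[ℤ], normSq s = p ∧ x = s * z by
    obtain ⟨s, z, hs, rfl⟩ := h
    obtain ⟨u, hu, h⟩ := Quaternion.exists_unit_mul_isOddRealEvenIm hp4 hs
    refine ⟨s * u, star u * z, h, ?_⟩
    rw [mul_assoc, ← mul_assoc u, self_mul_star, hu, coe_one, one_mul]
  have hp0 : (0 : ℤ) < p := by exact_mod_cast hp.pos
  obtain ⟨r, t, hrt, hr⟩ := Quaternion.exists_add_smul_normSq_lt hp0
    (by rw [Int.odd_iff]; omega) x
  obtain ⟨k, hk⟩ := Quaternion.dvd_normSq_of_eq_add_smul hrt hx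
  have hkp : k < p := by
    rw [hk, sq] at hr; exact lt_of_mul_lt_mul_left hr hp0.le
  obtain hk0 | rfl := (nonneg_of_mul_nonneg_right (hk ▸ normSq_nonneg) hp0).lt_or_eq
  · lift k to ℕ using hk0.le
    obtain ⟨n, hn⟩ := hx
    have hstar : star r = star x - (p : ℤ) • star t := by
      rw [hrt, star_add, star_zsmul, add_sub_cancel_right]
    refine Quaternion.exists_normSq_eq_prime_of_descent hp (by omega) x k r (n - star t * x)
      (by omega) (by omega) hk ?_
    rw [hstar, sub_mul, star_mul_self, hn, smul_mul_assoc, smul_sub]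
    congr 1
  · rw [mul_zero, normSq_eq_zero] at hk
    rw [hk, zero_add] at hrt
    obtain ⟨s, hs⟩ := exists_isLPSGenerator hp4
    refine ⟨s, star s * t, hs.1, ?_⟩
    rw [← mul_assoc, self_mul_star, hs.1, coe_mul_eq_smul, hrt]

namespace Matrix

variable {F : Type*} [Field F]

theorem of_fin_two_congr {R : Type*} {a b c d a' b' c' d' : R} (ha : a = a') (hb : b = b')
    (hc : c = c') (hd : d = d') : !![a, b; c, d] = !![a', b'; c', d'] := by
  rw [ha, hb, hc, hd]

theorem mem_submonoid_of_det_eq_one (S : Submonoid (Matrix (Fin 2) (Fin 2) F))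
    (hu : ∀ t : F, !![1, t; 0, 1] ∈ S) (hl : ∀ t : F, !![1, 0; t, 1] ∈ S)
    (A : Matrix (Fin 2) (Fin 2) F) (hA : A.det = 1) : A ∈ S := by
  have key : ∀ a b c d : F, c ≠ 0 → a * d - b * c = 1 → !![a, b; c, d] ∈ S := by
    intro a b c d hc h
    have : !![a, b; c, d] =
        !![1, (a - 1) / c; 0, 1] * !![1, 0; c, 1] * !![1, (d - 1) / c; 0, 1] := by
      obtain rfl : b = (a * d - 1) / c := by field_simp; linear_combination -h
      simp only [mul_fin_two]
      refine of_fin_two_congr ?_ ?_ ?_ ?_ <;> field_simp <;> ring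
    rw [this]
    exact mul_mem (mul_mem (hu _) (hl _)) (hu _)
  rw [det_fin_two] at hA
  rw [eta_fin_two A]
  by_cases hc : A 1 0 = 0
  · have ha : A 0 0 ≠ 0 := by
      intro ha
      simp [ha, hc] at hA
    have h := mul_mem (hl (-1)) (key (A 0 0) (A 0 1) (A 0 0 + A 1 0) (A 0 1 + A 1 1)
      (by rwa [hc, add_zero]) (by linear_combination hA))
    simpa [mul_fin_two] using h
  · exact key _ _ _ _ hc hA

theorem mem_submonoid_of_nilpotent_pair (S : Submonoid (Matrix (Fin 2) (Fin 2) F))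
    (h2 : (2 : F) ≠ 0) {a b c : F} (ha : a ≠ 0) (h : a ^ 2 + b * c = 0)
    (h₁ : ∀ r : F, !![1 + r * a, r * b; r * c, 1 - r * a] ∈ S)
    (h₂ : ∀ r : F, !![1 - r * a, r * b; r * c, 1 + r * a] ∈ S)
    (A : Matrix (Fin 2) (Fin 2) F) (hA : A.det = 1) : A ∈ S := by
  have hc : c ≠ 0 := by
    rintro rfl
    simp [ha] at h
  obtain rfl : b = -a ^ 2 / c := by field_simp; linear_combination h
  let P : Matrix (Fin 2) (Fin 2) F := !![a, -a; c, c]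
  let Q : Matrix (Fin 2) (Fin 2) F := !![1 / (2 * a), 1 / (2 * c); -(1 / (2 * a)), 1 / (2 * c)]
  have hPQ : P * Q = 1 := by
    simp only [P, Q, mul_fin_two, one_fin_two]
    refine of_fin_two_congr ?_ ?_ ?_ ?_ <;> field_simp <;> ring
  have hQP : Q * P = 1 := mul_eq_one_comm.1 hPQ
  let T : Submonoid (Matrix (Fin 2) (Fin 2) F) :=
    { carrier := {M | P * M * Q ∈ S}
      one_mem' := by simp [hPQ, one_mem]
      mul_mem' := fun {M N} hM hN => by
        have : P * M * Q * (P * N * Q) ∈ S := mul_mem hM hN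
        rwa [show P * M * Q * (P * N * Q) = P * M * (Q * P) * N * Q by noncomm_ring, hQP,
          mul_one, mul_assoc P M N] at this }
  have hT : Q * A * P ∈ T := by
    refine mem_submonoid_of_det_eq_one T (fun t => ?_) (fun t => ?_) _ ?_
    · change P * _ * Q ∈ S
      convert h₁ (-t / (2 * a)) using 1
      simp only [P, Q, mul_fin_two]
      refine of_fin_two_congr ?_ ?_ ?_ ?_ <;> field_simp <;> ring
    · change P * _ * Q ∈ S
      convert h₂ (t / (2 * a)) using 1
      simp only [P, Q, mul_fin_two]
      refine of_fin_two_congr ?_ ?_ ?_ ?_ <;> field_simp <;> ring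
    · rw [det_mul, det_mul, hA, mul_one, ← det_mul, hQP, det_one]
  change P * (Q * A * P) * Q ∈ S at hT
  rwa [show P * (Q * A * P) * Q = (P * Q) * A * (P * Q) by noncomm_ring, hPQ, one_mul,
    mul_one] at hT

theorem unipotent_mem_submonoid {q : ℕ} [Fact q.Prime]
    (S : Submonoid (Matrix (Fin 2) (Fin 2) (ZMod q)))
    (hS : ∀ t : ZMod q, t ≠ 0 → !![t, 0; 0, t] ∈ S) (h2 : (2 : ZMod q) ≠ 0) {t a b c : ZMod q}
    (ht : t ≠ 0) (h : a ^ 2 + b * c = 0) (hM : !![t + 2 * a, 2 * b; 2 * c, t - 2 * a] ∈ S)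
    (r : ZMod q) : !![1 + r * a, r * b; r * c, 1 - r * a] ∈ S := by
  have hpow : ∀ n : ℕ, !![1 + (n * (2 / t) : ZMod q) * a, (n * (2 / t) : ZMod q) * b;
      (n * (2 / t) : ZMod q) * c, 1 - (n * (2 / t) : ZMod q) * a] ∈ S := by
    intro n
    induction n with
    | zero => simpa [one_fin_two] using one_mem S
    | succ n ih =>
      convert mul_mem (mul_mem (hS t⁻¹ (inv_ne_zero ht)) hM) ih using 1
      simp only [mul_fin_two]
      push_cast
      refine of_fin_two_congr ?_ ?_ ?_ ?_ <;> field_simp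
      · linear_combination (-4 * n : ZMod q) * h
      · ring
      · ring
      · linear_combination (-4 * n : ZMod q) * h
  have := hpow (r * (t / 2)).val
  rwa [ZMod.natCast_zmod_val, show r * (t / 2) * (2 / t) = r by field_simp] at this

end Matrix

theorem exists_pow_sq_eq_sum_four_sq {p q : ℕ} (hp : p.Prime) (hq : q.Prime) (hp4 : p % 4 = 1)
    (hq4 : q % 4 = 1) (hpq : p ≠ q) :
    ∃ (k : ℕ) (a b c : ℤ), ((p : ℤ) ^ k - 4 * q) ^ 2 + (2 * a) ^ 2 + (2 * b) ^ 2 + (2 * c) ^ 2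
      = p ^ (2 * k) ∧ ¬ (q : ℤ) ∣ a := by
  obtain ⟨k, hk⟩ := pow_unbounded_of_one_lt (2 * q) hp.one_lt
  have hkZ : 2 * (q : ℤ) < p ^ k := by exact_mod_cast hk
  have hq0 : (0 : ℤ) < q := by exact_mod_cast hq.pos
  have hpk : p ^ k % 4 = 1 := by
    rw [Nat.pow_mod, hp4, one_pow, Nat.one_mod]
  obtain ⟨a, b, c, h⟩ := Int.exists_sum_three_sq_of_emod_four_eq_two
    (N := 2 * q * (p ^ k - 2 * q)) (mul_pos (by positivity) (by linarith)) (by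
      obtain ⟨u, hu⟩ : ∃ u : ℤ, (q : ℤ) = 4 * u + 1 := ⟨q / 4, by omega⟩
      obtain ⟨v, hv⟩ : ∃ v : ℤ, (p : ℤ) ^ k = 4 * v + 1 :=
        ⟨(p ^ k : ℕ) / 4, by rw [← Nat.cast_pow]; omega⟩
      rw [hu, hv]
      ring_nf
      omega)
  have hndvd : ¬ ((q : ℤ) ∣ a ∧ (q : ℤ) ∣ b ∧ (q : ℤ) ∣ c) := by
    rintro ⟨⟨a, rfl⟩, ⟨b, rfl⟩, ⟨c, rfl⟩⟩
    have h1 : (q : ℤ) * (a ^ 2 + b ^ 2 + c ^ 2) = 2 * (p ^ k - 2 * q) := by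
      refine mul_left_cancel₀ hq0.ne' ?_
      linear_combination h
    have h2 : (q : ℤ) ∣ (2 * p ^ k : ℕ) := ⟨a ^ 2 + b ^ 2 + c ^ 2 + 4, by push_cast; linarith⟩
    rw [Int.natCast_dvd_natCast, hq.dvd_mul] at h2
    rcases h2 with h2 | h2
    · have := Nat.le_of_dvd two_pos h2
      have := hq.two_le
      omega
    · exact hpq ((Nat.prime_dvd_prime_iff_eq hq hp).1 (hq.dvd_of_dvd_pow h2)).symm
  by_cases ha : (q : ℤ) ∣ a
  · by_cases hb : (q : ℤ) ∣ b
    · exact ⟨k, c, a, b, by linear_combination 4 * h, fun hc => hndvd ⟨ha, hb, hc⟩⟩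
    · exact ⟨k, b, a, c, by linear_combination 4 * h, hb⟩
  · exact ⟨k, a, b, c, by linear_combination 4 * h, ha⟩

section LPSMatrix

variable {R : Type*} [CommRing R] {i : R}

/-- The image of an integral quaternion in `M₂(R)`, where `R` contains a square root `i` of
`-1`. -/
def lpsMatrix (i : R) (x : ℍ[ℤ]) : Matrix (Fin 2) (Fin 2) R :=
  !![(x.re : R) + i * (x.imI : R), (x.imJ : R) + i * (x.imK : R);
    -(x.imJ : R) + i * (x.imK : R), (x.re : R) - i * (x.imI : R)]

theorem lpsMatrix_mul (hi : i ^ 2 = -1) (x y : ℍ[ℤ]) :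
    lpsMatrix i (x * y) = lpsMatrix i x * lpsMatrix i y := by
  simp only [lpsMatrix, mul_fin_two, re_mul, imI_mul, imJ_mul, imK_mul]
  push_cast
  refine of_fin_two_congr ?_ ?_ ?_ ?_
  · linear_combination (-x.imI * y.imI - x.imK * y.imK : R) * hi
  · linear_combination (-x.imI * y.imK + x.imK * y.imI : R) * hi
  · linear_combination (-x.imK * y.imI + x.imI * y.imK : R) * hi
  · linear_combination (-x.imI * y.imI - x.imK * y.imK : R) * hi

theorem lpsMatrix_intCast (n : ℤ) : lpsMatrix i (n : ℍ[ℤ]) = (n : R) • 1 := by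
  simp [lpsMatrix, one_fin_two]

theorem det_lpsMatrix (hi : i ^ 2 = -1) (x : ℍ[ℤ]) :
    (lpsMatrix i x).det = ((normSq x : ℤ) : R) := by
  rw [lpsMatrix, det_fin_two_of, normSq_def']
  push_cast
  linear_combination (-x.imI ^ 2 - x.imK ^ 2 : R) * hi

end LPSMatrix

theorem IsOddRealEvenIm.eq_one_or_neg_one {x : ℍ[ℤ]} (hx : IsOddRealEvenIm x)
    (h : normSq x = 1) : x = 1 ∨ x = -1 := by
  obtain ⟨-, h1, h2, h3⟩ := hx
  rw [normSq_def'] at h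
  have hzero : ∀ a : ℤ, Even a → a ^ 2 ≤ 1 → a = 0 := by
    rintro a ⟨b, rfl⟩ hb
    have : -1 < b := by nlinarith
    have : b < 1 := by nlinarith
    omega
  have h1 := hzero _ h1 (by nlinarith)
  have h2 := hzero _ h2 (by nlinarith)
  have h3 := hzero _ h3 (by nlinarith)
  rw [h1, h2, h3] at h
  rcases sq_eq_sq_iff_eq_or_eq_neg.1 (show x.re ^ 2 = 1 ^ 2 by linarith) with h | h
  · left; ext <;> simp [*]
  · right; ext <;> simp [*]

section PGL

variable {p q : ℕ} [Fact q.Prime] {i : ZMod q}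

theorem Matrix.GeneralLinearGroup.mem_center_of_val_eq_smul {A : GL (Fin 2) (ZMod q)}
    {c : ZMod q} (h : A.val = c • 1) : A ∈ Subgroup.center (GL (Fin 2) (ZMod q)) := by
  rw [mem_center_iff_val_mem_range_scalar]
  exact ⟨c, by rw [h, scalar_apply, ← smul_one_eq_diagonal]⟩

theorem exists_GL_val_eq_lpsMatrix (hi : i ^ 2 = -1) {x : ℍ[ℤ]}
    (hx : ((normSq x : ℤ) : ZMod q) ≠ 0) : ∃ A : GL (Fin 2) (ZMod q), A.val = lpsMatrix i x :=
  ⟨GeneralLinearGroup.mkOfDetNeZero (lpsMatrix i x) (by rwa [det_lpsMatrix hi]), rfl⟩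

/-- The matrices of the generators of the LPS graph. -/
def lpsGenerators (p : ℕ) (i : ZMod q) : Set (GL (Fin 2) (ZMod q)) :=
  {A | ∃ s, IsLPSGenerator p s ∧ A.val = lpsMatrix i s}

theorem mem_subgroup_of_normSq_eq_pow (hp : p.Prime) (hp4 : p % 4 = 1) (hpq : (p : ZMod q) ≠ 0)
    (hi : i ^ 2 = -1) {K : Subgroup (GL (Fin 2) (ZMod q))} (hK : Subgroup.center _ ≤ K)
    (hg : lpsGenerators p i ⊆ K) (k : ℕ) : ∀ (x : ℍ[ℤ]) (A : GL (Fin 2) (ZMod q)),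
      IsOddRealEvenIm x → normSq x = p ^ k → A.val = lpsMatrix i x → A ∈ K := by
  induction k with
  | zero =>
    intro x A hx hn hA
    refine hK ?_
    rcases hx.eq_one_or_neg_one (by simpa using hn) with rfl | rfl
    · exact GeneralLinearGroup.mem_center_of_val_eq_smul (c := 1)
        (hA.trans (by simpa using lpsMatrix_intCast (i := i) 1))
    · exact GeneralLinearGroup.mem_center_of_val_eq_smul (c := -1)
        (hA.trans (by simpa using lpsMatrix_intCast (i := i) (-1)))
  | succ k ih =>
    intro x A hx hn hA
    obtain ⟨s, y, hs, rfl⟩ := exists_isLPSGenerator_mul_eq hp hp4 (x := x)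
      (hn ▸ dvd_pow_self _ k.succ_ne_zero)
    obtain ⟨B, hB⟩ := exists_GL_val_eq_lpsMatrix hi (x := s) (by rw [hs.1]; exact_mod_cast hpq)
    have hBK : B ∈ K := hg ⟨s, hs, hB⟩
    rw [← K.mul_mem_cancel_left (K.inv_mem hBK)]
    refine ih y _ (hs.2.2.of_mul_left hx) ?_ ?_
    · rw [map_mul, hs.1, pow_succ'] at hn
      exact mul_left_cancel₀ (by exact_mod_cast hp.ne_zero) hn
    · rw [Units.val_mul, hA, lpsMatrix_mul hi, ← hB, Units.inv_mul_cancel_left]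

theorem mem_subgroup_of_lpsGenerators_subset (hp : p.Prime) (hp4 : p % 4 = 1)
    (hq4 : q % 4 = 1) (hnr : ¬ IsSquare (p : ZMod q)) (hi : i ^ 2 = -1)
    {K : Subgroup (GL (Fin 2) (ZMod q))} (hK : Subgroup.center _ ≤ K)
    (hg : lpsGenerators p i ⊆ K) (A : GL (Fin 2) (ZMod q)) : A ∈ K := by
  have hq : q.Prime := Fact.out
  have hpq : (p : ZMod q) ≠ 0 := by
    intro h
    simp [h] at hnr
  have h2 : (2 : ZMod q) ≠ 0 := by
    refine Ring.two_ne_zero ?_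
    rw [ZMod.ringChar_zmod_n]
    omega
  let S := K.toSubmonoid.map (Units.coeHom (Matrix (Fin 2) (Fin 2) (ZMod q)))
  have hmem : ∀ {B : GL (Fin 2) (ZMod q)}, B.val ∈ S → B ∈ K := by
    rintro B ⟨C, hC, hCB⟩
    rwa [← Units.ext hCB]
  have hscalar : ∀ t : ZMod q, t ≠ 0 → !![t, 0; 0, t] ∈ S := by
    intro t ht
    refine ⟨GeneralLinearGroup.mkOfDetNeZero !![t, 0; 0, t] (by simp [ht]), hK ?_, rfl⟩
    refine GeneralLinearGroup.mem_center_of_val_eq_smul (c := t) ?_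
    change !![t, 0; 0, t] = _
    simp [one_fin_two]
  obtain ⟨k, a, b, c, habc, ha⟩ := exists_pow_sq_eq_sum_four_sq hp hq hp4 hq4
    (by rintro rfl; simp at hpq)
  have hx : ∀ a : ℤ, ((p : ℤ) ^ k - 4 * q) ^ 2 + (2 * a) ^ 2 + (2 * b) ^ 2 + (2 * c) ^ 2
      = p ^ (2 * k) → !![(p ^ k : ZMod q) + 2 * (i * a), 2 * (b + i * c);
        2 * (-b + i * c), p ^ k - 2 * (i * a)] ∈ S := by
    intro a h
    rw [← Quaternion.normSq_ofCoords] at h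
    obtain ⟨B, hB⟩ := exists_GL_val_eq_lpsMatrix (i := i) hi (x := ofCoords _ _ _ _)
      (by rw [h]; push_cast; exact pow_ne_zero _ hpq)
    refine ⟨B, mem_subgroup_of_normSq_eq_pow hp hp4 hpq hi hK hg (2 * k) _ B ?_ h hB, ?_⟩
    · refine ⟨?_, even_two_mul _, even_two_mul _, even_two_mul _⟩
      have : Odd ((p : ℤ) ^ k) := Odd.pow (by rw [Int.odd_iff]; omega)
      exact this.sub_even ⟨2 * q, by ring⟩
    · refine hB.trans ?_
      simp only [lpsMatrix, re_ofCoords, imI_ofCoords, imJ_ofCoords, imK_ofCoords]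
      push_cast
      simp only [CharP.cast_eq_zero]
      refine of_fin_two_congr ?_ ?_ ?_ ?_ <;> ring
  have ha' : i * (a : ZMod q) ≠ 0 := by
    refine mul_ne_zero ?_ ?_
    · rintro rfl
      simp at hi
    · rwa [Ne, ZMod.intCast_zmod_eq_zero_iff_dvd]
  have hnil : (i * a : ZMod q) ^ 2 + (b + i * c) * (-b + i * c) = 0 := by
    have h4 : (4 : ZMod q) ≠ 0 := by
      rw [show (4 : ZMod q) = 2 * 2 by norm_num]
      exact mul_ne_zero h2 h2
    have h := congrArg (Int.cast : ℤ → ZMod q) habc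
    push_cast at h
    simp only [CharP.cast_eq_zero] at h
    refine mul_left_cancel₀ h4 ?_
    linear_combination (4 * a ^ 2 + 4 * c ^ 2 : ZMod q) * hi - h
  have hpk : (p ^ k : ZMod q) ≠ 0 := pow_ne_zero _ hpq
  have hSL : ∀ B : Matrix (Fin 2) (Fin 2) (ZMod q), B.det = 1 → B ∈ S := by
    refine mem_submonoid_of_nilpotent_pair S h2 ha' hnil
      (unipotent_mem_submonoid S hscalar h2 hpk hnil (hx a habc)) fun r => ?_
    have := unipotent_mem_submonoid S hscalar h2 hpk (a := -(i * a)) (b := b + i * c)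
      (c := -b + i * c) (by rwa [neg_sq])
      (by simpa using hx (-a) (by rwa [mul_neg, neg_sq])) r
    simpa [sub_eq_add_neg] using this
  have hsquare : ∀ B : GL (Fin 2) (ZMod q), IsSquare B.val.det → B ∈ K := by
    rintro B ⟨t, ht⟩
    have ht0 : t ≠ 0 := by
      rintro rfl
      exact (B.isUnit.map detMonoidHom).ne_zero (by simpa using ht)
    have h1 := hSL (t⁻¹ • B.val) (by
      rw [det_smul, ht, Fintype.card_fin]; field_simp)
    refine hmem ?_
    convert mul_mem (hscalar t ht0) h1
    rw [show !![t, 0; 0, t] = t • (1 : Matrix (Fin 2) (Fin 2) (ZMod q)) by simp [one_fin_two],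
      smul_mul_smul_comm, mul_inv_cancel₀ ht0, one_mul, one_smul]
  by_cases hA : IsSquare A.val.det
  · exact hsquare A hA
  · obtain ⟨s, hs⟩ := exists_isLPSGenerator hp4
    obtain ⟨B, hB⟩ := exists_GL_val_eq_lpsMatrix hi (x := s) (by rw [hs.1]; exact_mod_cast hpq)
    rw [← K.mul_mem_cancel_right (hg ⟨s, hs, hB⟩)]
    refine hsquare _ ?_
    rw [Units.val_mul, det_mul, hB, det_lpsMatrix hi, hs.1]
    have hdet : A.val.det ≠ 0 := fun h => hA (h ▸ .zero)
    rw [← quadraticChar_one_iff_isSquare (mul_ne_zero hdet (by exact_mod_cast hpq)), map_mul,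
      quadraticChar_neg_one_iff_not_isSquare.2 hA,
      quadraticChar_neg_one_iff_not_isSquare.2 (by exact_mod_cast hnr)]
    rfl

end PGL

section LPSGraph

variable {p q : ℕ} [Fact q.Prime] {i : ZMod q}

/-- The LPS graph on `PGL₂(ℤ/q)`. -/
def lpsGraph (p : ℕ) (i : ZMod q) :
    SimpleGraph (GL (Fin 2) (ZMod q) ⧸ Subgroup.center (GL (Fin 2) (ZMod q))) :=
  SimpleGraph.fromRel fun x y => ∃ A ∈ lpsGenerators p i, y = x * QuotientGroup.mk A

theorem exists_coords_iff_exists_mem_lpsGenerators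
    {x y : GL (Fin 2) (ZMod q) ⧸ Subgroup.center (GL (Fin 2) (ZMod q))} :
    (∃ (A : GL (Fin 2) (ZMod q)) (x₀ x₁ x₂ x₃ : ℤ),
        x₀ ^ 2 + x₁ ^ 2 + x₂ ^ 2 + x₃ ^ 2 = (p : ℤ) ∧ 0 < x₀ ∧ Odd x₀ ∧
        Even x₁ ∧ Even x₂ ∧ Even x₃ ∧
        (A : Matrix (Fin 2) (Fin 2) (ZMod q)) =
          !![(x₀ : ZMod q) + i * (x₁ : ZMod q), (x₂ : ZMod q) + i * (x₃ : ZMod q);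
             -(x₂ : ZMod q) + i * (x₃ : ZMod q), (x₀ : ZMod q) - i * (x₁ : ZMod q)] ∧
        y = x * QuotientGroup.mk A) ↔
      ∃ A ∈ lpsGenerators p i, y = x * QuotientGroup.mk A := by
  constructor
  · rintro ⟨A, a, b, c, d, h, h0, ha, hb, hc, hd, hA, hy⟩
    exact ⟨A, ⟨ofCoords a b c d, ⟨(normSq_ofCoords a b c d).trans h, h0, ha, hb, hc, hd⟩, hA⟩, hy⟩
  · rintro ⟨A, ⟨s, ⟨h, h0, ha, hb, hc, hd⟩, hA⟩, hy⟩
    exact ⟨A, s.re, s.imI, s.imJ, s.imK, by rw [← h, normSq_def'], h0, ha, hb, hc, hd, hA, hy⟩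

theorem lpsGraph_connected (hp : p.Prime) (hp4 : p % 4 = 1)
    (hq4 : q % 4 = 1) (hnr : ¬ IsSquare (p : ZMod q)) (hi : i ^ 2 = -1) :
    (lpsGraph p i).Connected := by
  let K : Subgroup (GL (Fin 2) (ZMod q)) :=
    { carrier := {A | ∀ g, (lpsGraph p i).Reachable g (g * QuotientGroup.mk A)}
      one_mem' := fun g => by rw [QuotientGroup.mk_one, mul_one]
      mul_mem' := fun {A B} hA hB g => by
        rw [QuotientGroup.mk_mul, ← mul_assoc]
        exact (hA g).trans (hB _)
      inv_mem' := fun {A} hA g => by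
        have h := (hA (g * (QuotientGroup.mk A)⁻¹)).symm
        rwa [inv_mul_cancel_right] at h }
  have hK : ∀ A, A ∈ K := by
    refine mem_subgroup_of_lpsGenerators_subset hp hp4 hq4 hnr hi ?_ ?_
    · intro A hA g
      rw [(QuotientGroup.eq_one_iff A).2 hA, mul_one]
    · intro A hA g
      by_cases h : g = g * QuotientGroup.mk A
      · rw [← h]
      · exact SimpleGraph.Adj.reachable ⟨h, .inl ⟨A, hA, rfl⟩⟩
  refine (SimpleGraph.connected_iff _).2 ⟨fun x y => ?_, ⟨1⟩⟩
  obtain ⟨A, hA⟩ := QuotientGroup.mk_surjective (x⁻¹ * y)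
  simpa [hA] using hK A x

theorem exists_normSq_eq_pow_length_of_walk (hpq : (p : ZMod q) ≠ 0) (hi : i ^ 2 = -1)
    {u v : GL (Fin 2) (ZMod q) ⧸ Subgroup.center (GL (Fin 2) (ZMod q))}
    (w : (lpsGraph p i).Walk u v) : ∃ (x : ℍ[ℤ]) (A : GL (Fin 2) (ZMod q)),
      normSq x = p ^ w.length ∧ IsOddRealEvenIm x ∧ A.val = lpsMatrix i x ∧
        v = u * QuotientGroup.mk A := by
  induction w with
  | nil =>
    exact ⟨1, 1, by simp, by simp [IsOddRealEvenIm],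
      by simpa using (lpsMatrix_intCast (i := i) 1).symm, by simp⟩
  | @cons u v w huv _ ih =>
    obtain ⟨x, A, hx, hx', hA, rfl⟩ := ih
    suffices h : ∃ (s : ℍ[ℤ]) (B : GL (Fin 2) (ZMod q)), IsLPSGenerator p s ∧
        B.val = lpsMatrix i s ∧ v = u * QuotientGroup.mk B by
      obtain ⟨s, B, hs, hB, rfl⟩ := h
      refine ⟨s * x, B * A, ?_, hs.2.2.mul hx', ?_, ?_⟩
      · rw [map_mul, hs.1, hx, SimpleGraph.Walk.length_cons, pow_succ']
      · rw [Units.val_mul, hA, hB, lpsMatrix_mul hi]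
      · rw [QuotientGroup.mk_mul, mul_assoc]
    rcases huv.2 with ⟨B, ⟨s, hs, hB⟩, h⟩ | ⟨B, ⟨s, hs, hB⟩, h⟩
    · exact ⟨s, B, hs, hB, h⟩
    · obtain ⟨C, hC⟩ := exists_GL_val_eq_lpsMatrix hi (x := star s)
        (by rw [hs.star.1]; exact_mod_cast hpq)
      refine ⟨star s, C, hs.star, hC, ?_⟩
      have hBC : QuotientGroup.mk (s := Subgroup.center (GL (Fin 2) (ZMod q))) (B * C) = 1 := by
        rw [QuotientGroup.eq_one_iff]
        refine GeneralLinearGroup.mem_center_of_val_eq_smul (c := (p : ZMod q)) ?_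
        rw [Units.val_mul, hB, hC, ← lpsMatrix_mul hi, self_mul_star, hs.1]
        exact (lpsMatrix_intCast (p : ℤ)).trans (by rw [Int.cast_natCast])
      rw [h, mul_assoc, ← QuotientGroup.mk_mul, hBC, mul_one]

theorem exists_smul_eq_of_mk_eq_mk {A B : GL (Fin 2) (ZMod q)}
    (h : QuotientGroup.mk (s := Subgroup.center (GL (Fin 2) (ZMod q))) A = QuotientGroup.mk B) :
    ∃ c : ZMod q, A.val = c • B.val := by
  obtain ⟨c, hc⟩ := GeneralLinearGroup.mem_center_iff_val_mem_range_scalar.1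
    (QuotientGroup.eq.1 h.symm)
  refine ⟨c, ?_⟩
  have h1 : A.val = B.val * (B⁻¹ * A).val := by
    rw [Units.val_mul, Units.mul_inv_cancel_left]
  rw [h1, ← hc, scalar_apply, ← smul_one_eq_diagonal, mul_smul_comm, mul_one]

theorem pow_four_le_of_lpsMatrix_eq_smul (hp : p.Prime) (hq2 : q ≠ 2)
    (hnr : ¬ IsSquare (p : ZMod q)) (hi : i ^ 2 = -1) {n : ℕ} {x : ℍ[ℤ]}
    (hn : normSq x = p ^ n) (hx : IsOddRealEvenIm x) {c : ZMod q}
    (hW : lpsMatrix i x = c • !![0, 1; -1, 0]) : q ^ 4 ≤ 4 * p ^ n := by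
  have hq : q.Prime := Fact.out
  have h2 : (2 : ZMod q) ≠ 0 := Ring.two_ne_zero (by rwa [ZMod.ringChar_zmod_n])
  have hi0 : i ≠ 0 := by
    rintro rfl
    simp at hi
  have h00 := congrFun (congrFun hW 0) 0
  have h01 := congrFun (congrFun hW 0) 1
  have h10 := congrFun (congrFun hW 1) 0
  have h11 := congrFun (congrFun hW 1) 1
  simp [lpsMatrix] at h00 h01 h10 h11
  have hre : (x.re : ZMod q) = 0 := mul_left_cancel₀ h2 (by linear_combination h00 + h11)
  have hI : (x.imI : ZMod q) = 0 :=
    mul_left_cancel₀ (mul_ne_zero h2 hi0) (by linear_combination h00 - h11)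
  have hK : (x.imK : ZMod q) = 0 :=
    mul_left_cancel₀ (mul_ne_zero h2 hi0) (by linear_combination h01 + h10)
  have hpq : (p : ZMod q) ≠ 0 := fun h => hnr (h ▸ .zero)
  rw [normSq_def'] at hn
  have heven : Even n := by
    by_contra hodd
    obtain ⟨k, rfl⟩ := Nat.not_even_iff_odd.1 hodd
    refine hnr ⟨x.imJ / p ^ k, ?_⟩
    have h := congrArg (Int.cast : ℤ → ZMod q) hn
    push_cast at h
    rw [hre, hI, hK] at h
    field_simp
    linear_combination -h
  obtain ⟨k, rfl⟩ := heven
  rw [ZMod.intCast_zmod_eq_zero_iff_dvd] at hre hI hK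
  have hqZ : Prime (q : ℤ) := Nat.prime_iff_prime_int.1 hq
  have hP : (0 : ℤ) < p ^ k := by exact_mod_cast pow_pos hp.pos k
  have hprod : (q : ℤ) ^ 2 ∣ (p ^ k - x.imJ) * (p ^ k + x.imJ) := by
    rw [show ((p : ℤ) ^ k - x.imJ) * (p ^ k + x.imJ) = x.re ^ 2 + x.imI ^ 2 + x.imK ^ 2 by
      linear_combination -hn]
    exact dvd_add (dvd_add (pow_dvd_pow_of_dvd hre 2) (pow_dvd_pow_of_dvd hI 2))
      (pow_dvd_pow_of_dvd hK 2)
  have hre0 : 0 < x.re ^ 2 := by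
    refine sq_pos_of_ne_zero fun h => ?_
    have := hx.1
    rw [h] at this
    exact absurd this (by decide)
  have hJ : x.imJ ^ 2 < (p ^ k) ^ 2 := by
    rw [← pow_mul, mul_two]
    linarith [sq_nonneg x.imI, sq_nonneg x.imK]
  obtain ⟨hJ1, hJ2⟩ := abs_lt.1 (abs_lt_of_sq_lt_sq hJ hP.le)
  have hlt : (q : ℤ) ^ 2 ≤ 2 * p ^ k := by
    by_cases hd : (q : ℤ) ∣ p ^ k - x.imJ
    · have hnd : ¬ (q : ℤ) ∣ p ^ k + x.imJ := by
        intro hd'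
        have h3 := dvd_add hd hd'
        rw [show (p : ℤ) ^ k - x.imJ + (p ^ k + x.imJ) = 2 * p ^ k by ring,
          ← ZMod.intCast_zmod_eq_zero_iff_dvd] at h3
        push_cast at h3
        exact mul_ne_zero h2 (pow_ne_zero k hpq) h3
      have := Int.le_of_dvd (by linarith) (hqZ.pow_dvd_of_dvd_mul_right 2 hnd hprod)
      linarith
    · have := Int.le_of_dvd (by linarith) (hqZ.pow_dvd_of_dvd_mul_left 2 hd hprod)
      linarith
  suffices h : (q : ℤ) ^ 4 ≤ 4 * (p : ℤ) ^ (k + k) by exact_mod_cast h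
  calc (q : ℤ) ^ 4 = ((q : ℤ) ^ 2) ^ 2 := by ring
    _ ≤ (2 * (p : ℤ) ^ k) ^ 2 := pow_le_pow_left₀ (by positivity) hlt 2
    _ = 4 * (p : ℤ) ^ (k + k) := by ring

end LPSGraph

/-- Let `p`, `q` be primes, `p ≡ 1 (mod 4)`, `q ≡ 1 (mod 4)`, with
`p` a quadratic non-residue mod `q`. In the bipartite LPS Ramanujan graph `X_{p,q}`
on `PGL₂(ZMod q)` (the Cayley-type graph obtained by symmetrizing right
multiplication by the classes of the `p+1` matrices
`![![x₀+i·x₁, x₂+i·x₃], ![−x₂+i·x₃, x₀−i·x₁]]` coming from the representations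
`x₀²+x₁²+x₂²+x₃² = p` with `x₀ > 0` odd and `x₁,x₂,x₃` even), the distance `d`
between the identity class and the class of `W = ![![0,1],![−1,0]]` satisfies
`(d : ℝ) ≥ log_p (q⁴/4)`; consequently
`(diam : ℝ) ≥ (4/3)·log_p ((q³−q)/2) − (2/3)·log_p 2`. -/
theorem lps_bipartite_diameter_lower_bound
    (p q : ℕ) (hp : p.Prime) (hq : q.Prime) (hp4 : p % 4 = 1) (hq4 : q % 4 = 1)
    (hnr : ¬ IsSquare ((p : ZMod q)))
    (i : ZMod q) (hi : i ^ 2 = -1)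
    (X : SimpleGraph
      (GL (Fin 2) (ZMod q) ⧸ Subgroup.center (GL (Fin 2) (ZMod q))))
    (hX : X = SimpleGraph.fromRel (fun x y =>
      ∃ (A : GL (Fin 2) (ZMod q)) (x₀ x₁ x₂ x₃ : ℤ),
        x₀ ^ 2 + x₁ ^ 2 + x₂ ^ 2 + x₃ ^ 2 = (p : ℤ) ∧ 0 < x₀ ∧ Odd x₀ ∧
        Even x₁ ∧ Even x₂ ∧ Even x₃ ∧
        (A : Matrix (Fin 2) (Fin 2) (ZMod q)) =
          !![(x₀ : ZMod q) + i * (x₁ : ZMod q), (x₂ : ZMod q) + i * (x₃ : ZMod q);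
             -(x₂ : ZMod q) + i * (x₃ : ZMod q), (x₀ : ZMod q) - i * (x₁ : ZMod q)] ∧
        y = x * QuotientGroup.mk A))
    (W : GL (Fin 2) (ZMod q))
    (hW : (W : Matrix (Fin 2) (Fin 2) (ZMod q)) = !![0, 1; -1, 0]) :
    (X.dist 1 (QuotientGroup.mk W) : ℝ) ≥ Real.logb p ((q : ℝ) ^ 4 / 4) ∧
    (X.diam : ℝ) ≥ (4 / 3) * Real.logb p (((q : ℝ) ^ 3 - (q : ℝ)) / 2)
        - (2 / 3) * Real.logb p 2 := by
  have := Fact.mk hq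
  obtain rfl : X = lpsGraph p i := by
    rw [hX]
    simp only [exists_coords_iff_exists_mem_lpsGenerators]
    rfl
  have hconn := lpsGraph_connected hp hp4 hq4 hnr hi
  have hp1 : (1 : ℝ) < p := by exact_mod_cast hp.one_lt
  have hq1 : (1 : ℝ) < q := by exact_mod_cast hq.one_lt
  have hdist : Real.logb p ((q : ℝ) ^ 4 / 4) ≤ (lpsGraph p i).dist 1 (QuotientGroup.mk W) := by
    obtain ⟨w, hw⟩ := hconn.exists_walk_length_eq_dist 1 (QuotientGroup.mk W)
    obtain ⟨x, A, hx, hx', hA, hWA⟩ :=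
      exists_normSq_eq_pow_length_of_walk (fun h => hnr (h ▸ .zero)) hi w
    rw [one_mul] at hWA
    obtain ⟨c, hc⟩ := exists_smul_eq_of_mk_eq_mk hWA.symm
    have h := pow_four_le_of_lpsMatrix_eq_smul hp (by omega) hnr hi hx hx' (c := c)
      (by rw [← hA, hc, hW])
    rw [hw] at h
    have h' : (q : ℝ) ^ 4 ≤ 4 * p ^ (lpsGraph p i).dist 1 (QuotientGroup.mk W) := by
      exact_mod_cast h
    rw [Real.logb_le_iff_le_rpow hp1 (by positivity), Real.rpow_natCast]
    linarith
  refine ⟨hdist, ?_⟩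
  have hdiam : ((lpsGraph p i).dist 1 (QuotientGroup.mk W) : ℝ) ≤ (lpsGraph p i).diam := by
    exact_mod_cast SimpleGraph.dist_le_diam (SimpleGraph.connected_iff_ediam_ne_top.1 hconn)
  have h1 : Real.logb p (((q : ℝ) ^ 3 - q) / 2) ≤ Real.logb p ((q : ℝ) ^ 3 / 2) := by
    have : (q : ℝ) < q ^ 3 := lt_self_pow₀ hq1 (by norm_num)
    exact Real.logb_le_logb_of_le hp1 (by linarith) (by linarith)
  rw [Real.logb_div (x := (q : ℝ) ^ 3) (by positivity) (by norm_num), Real.logb_pow] at h1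
  rw [Real.logb_div (by positivity) (by norm_num), Real.logb_pow] at hdist
  rw [show (4 : ℝ) = 2 ^ 2 by norm_num, Real.logb_pow] at hdist
  push_cast at h1 hdist
  linarith
end
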